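/- arXiv:math/0305223 — 3 statements merged into one kernel-verified Lean document; each statement's English description precedes it below -/
import Mathlib

section
/- Let v ∈ L^∞(ℝ²) ∩ C²(ℝ²) be a solution of -Δv = (1 + |x|²/8)^{-2} v in ℝ². Then there exist constants a₁, a₂, b ∈ ℝ such that v(x) = a₁ x₁/(1 + |x|²/8) + a₂ x₂/(1 + |x|²/8) + b (8 - |x|²)/(8 + |x|²). -/
open MeasureTheory Real

noncomputable def lap (u : EuclideanSpace ℝ (Fin 2) → ℝ) (x : EuclideanSpace ℝ (Fin 2)) : ℝ :=
  ∑ i : Fin 2, fderiv ℝ (fun y => fderiv ℝ u y (EuclideanSpace.single i 1)) x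
    (EuclideanSpace.single i 1)

lemma tanh_hd (t : ℝ) : HasDerivAt Real.tanh (1 - Real.tanh t ^ 2) t := by
  have h : Real.tanh = fun s => Real.sinh s / Real.cosh s := by
    funext s; exact Real.tanh_eq_sinh_div_cosh s
  have hc := (Real.cosh_pos t).ne'
  have h2 := (Real.hasDerivAt_sinh t).div (Real.hasDerivAt_cosh t) hc
  rw [h]
  refine h2.congr_deriv ?_
  field_simp

lemma wron_const {w w' p p' k : ℝ → ℝ}
    (hw : ∀ t, HasDerivAt w (w' t) t) (hw' : ∀ t, HasDerivAt w' (k t * w t) t)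
    (hp : ∀ t, HasDerivAt p (p' t) t) (hp' : ∀ t, HasDerivAt p' (k t * p t) t) :
    ∃ a, ∀ t, w t * p' t - w' t * p t = a := by
  have h : ∀ t, HasDerivAt (fun t => w t * p' t - w' t * p t) 0 t := fun t => by
    refine (((hw t).mul (hp' t)).sub ((hw' t).mul (hp t))).congr_deriv ?_
    ring
  refine ⟨_, fun t => is_const_of_deriv_eq_zero (fun t => (h t).differentiableAt)
    (fun t => (h t).deriv) t 0⟩

lemma ode_span {w w' p p' q q' k : ℝ → ℝ} {W : ℝ} (hW : W ≠ 0)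
    (hw : ∀ t, HasDerivAt w (w' t) t) (hw' : ∀ t, HasDerivAt w' (k t * w t) t)
    (hp : ∀ t, HasDerivAt p (p' t) t) (hp' : ∀ t, HasDerivAt p' (k t * p t) t)
    (hq : ∀ t, HasDerivAt q (q' t) t) (hq' : ∀ t, HasDerivAt q' (k t * q t) t)
    (h : ∀ t, p' t * q t - q' t * p t = W) :
    ∃ a b, ∀ t, w t = a * p t + b * q t := by
  obtain ⟨a, ha⟩ := wron_const hw hw' hp hp'
  obtain ⟨b, hb⟩ := wron_const hw hw' hq hq'
  refine ⟨-b / W, a / W, fun t => ?_⟩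
  field_simp
  rw [← h t, ← ha t, ← hb t]; ring

lemma nonpos_of_lin {A C : ℝ} (h : ∀ t : ℝ, 0 ≤ t → A * t ≤ C) : A ≤ 0 := by
  by_contra! hA
  have h1 := h ((|C| + 1) / A) (by positivity)
  rw [mul_div_cancel₀ _ hA.ne'] at h1
  linarith [le_abs_self C]

lemma mode_ge_two {w w' : ℝ → ℝ} {n : ℝ} (hn : 2 ≤ n) {M : ℝ} (hM : ∀ t, |w t| ≤ M)
    (hw : ∀ t, HasDerivAt w (w' t) t)
    (hw' : ∀ t, HasDerivAt w' ((n ^ 2 - 2 * (1 - Real.tanh t ^ 2)) * w t) t) :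
    ∀ t, w t = 0 := by
  have key : ∀ m t : ℝ, HasDerivAt (fun t => Real.exp (m * t)) (Real.exp (m * t) * m) t := 
    fun m t => by simpa using ((hasDerivAt_id t).const_mul m).exp
  have P1 : ∀ m t : ℝ, HasDerivAt (fun t => Real.exp (m * t) * (m - Real.tanh t))
    (Real.exp (m * t) * (m ^ 2 - m * Real.tanh t - (1 - Real.tanh t ^ 2))) t := fun m t => by
    refine ((key m t).mul ((tanh_hd t).const_sub m)).congr_deriv ?_
    ring
  have P2 : ∀ m t : ℝ, HasDerivAt (fun t => Real.exp (m * t) * (m ^ 2 - m * Real.tanh t - (1 - Real.tanh t ^ 2)))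
    ((m ^ 2 - 2 * (1 - Real.tanh t ^ 2)) * (Real.exp (m * t) * (m - Real.tanh t))) t := fun m t => by
    refine ((key m t).mul ((((tanh_hd t).const_mul m).const_sub (m^2)).sub
      (((tanh_hd t).pow 2).const_sub 1))).congr_deriv ?_
    simp
    ring
  obtain ⟨a, b, hab⟩ := ode_span (W := -(2 * n * (n ^ 2 - 1)))
    (k := fun t => (n ^ 2 - 2 * (1 - Real.tanh t ^ 2)))
    (neg_ne_zero.2 (by have : 0 < n ^ 2 - 1 := by nlinarith
                       positivity)) hw hw' (P1 n) (P2 n) (P1 (-n))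
    (fun t => by simpa using P2 (-n) t) (fun t => by
      have : Real.exp (n * t) * Real.exp (-n * t) = 1 := by rw [← Real.exp_add]; simp
      linear_combination (-(2 * n * (n ^ 2 - 1))) * this)
  have hb1 : ∀ t, |Real.tanh t| < 1 := Real.abs_tanh_lt_one
  have main : ∀ (c d : ℝ) (m : ℝ), (m = n ∨ m = -n) → (∀ t, w t = c * (Real.exp (m * t) * (m - Real.tanh t)) +
      d * (Real.exp (-m * t) * (-m - Real.tanh t))) → c = 0 := by
    intro c d m hm hcd
    have hm' : |m| = n := by
      rcases hm with h | h <;> rw [h]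
      · exact abs_of_pos (by linarith)
      · rw [abs_neg]; exact abs_of_pos (by linarith)
    have : |c| ≤ 0 := by
      apply nonpos_of_lin (C := M + |d| * (n + 1))
      intro s hs
      obtain ⟨t, ht⟩ : ∃ t, m * t = n * s := by
        rcases hm with h | h
        · exact ⟨s, by rw [h]⟩
        · exact ⟨-s, by rw [h]; ring⟩
      have e1 : |c * (Real.exp (m * t) * (m - Real.tanh t))| ≤ M + |d * (Real.exp (-m * t) * (-m - Real.tanh t))| := by
        have : c * (Real.exp (m * t) * (m - Real.tanh t)) = w t - d * (Real.exp (-m * t) * (-m - Real.tanh t)) := by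
          rw [hcd t]; ring
        rw [this]
        exact (abs_sub _ _).trans (by linarith [hM t])
      have e2 : |d * (Real.exp (-m * t) * (-m - Real.tanh t))| ≤ |d| * (n + 1) := by
        rw [abs_mul, abs_mul]
        gcongr
        have i1 : |Real.exp (-m * t)| ≤ 1 := by
          rw [abs_of_pos (Real.exp_pos _), Real.exp_le_one_iff]
          nlinarith
        have i2 : |-m - Real.tanh t| ≤ n + 1 := by
          refine (abs_sub _ _).trans ?_
          rw [abs_neg, hm']; linarith [hb1 t]
        calc _ ≤ 1 * |-m - Real.tanh t| := by gcongr
          _ ≤ _ := by linarith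
      have e3 : |c| * s ≤ |c * (Real.exp (m * t) * (m - Real.tanh t))| := by
        rw [abs_mul, abs_mul]
        gcongr
        have i1 : s ≤ |Real.exp (m * t)| := by
          rw [abs_of_pos (Real.exp_pos _), ht]
          have := Real.add_one_le_exp (n * s)
          nlinarith
        have i2 : 1 ≤ |m - Real.tanh t| := by
          have := abs_sub_abs_le_abs_sub m (Real.tanh t)
          linarith [hb1 t]
        nlinarith
      linarith
    exact abs_nonpos_iff.1 this
  have ha := main a b n (Or.inl rfl) hab
  have hb := main b a (-n) (Or.inr rfl) (fun t => by rw [hab t]; simp; ring)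
  intro t
  rw [hab, ha, hb]; ring

lemma mode_one {w w' : ℝ → ℝ} {M : ℝ} (hM : ∀ t, |w t| ≤ M)
    (hw : ∀ t, HasDerivAt w (w' t) t)
    (hw' : ∀ t, HasDerivAt w' ((1 ^ 2 - 2 * (1 - Real.tanh t ^ 2)) * w t) t) :
    ∃ a, ∀ t, w t = a * (Real.cosh t)⁻¹ := by
  have S1 : ∀ t : ℝ, HasDerivAt (fun t => (Real.cosh t)⁻¹) (-((Real.cosh t)⁻¹ * Real.tanh t)) t := fun t => by
    refine ((Real.hasDerivAt_cosh t).inv (Real.cosh_pos t).ne').congr_deriv ?_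
    rw [Real.tanh_eq_sinh_div_cosh]
    have := (Real.cosh_pos t).ne'
    field_simp
  have S2 : ∀ t : ℝ, HasDerivAt (fun t => -((Real.cosh t)⁻¹ * Real.tanh t)) 
      ((1 ^ 2 - 2 * (1 - Real.tanh t ^ 2)) * (Real.cosh t)⁻¹) t := fun t => by
    refine ((S1 t).mul (tanh_hd t)).neg.congr_deriv ?_
    ring
  have Q1 : ∀ t : ℝ, HasDerivAt (fun t => t * (Real.cosh t)⁻¹ + Real.sinh t)
      ((Real.cosh t)⁻¹ + t * (-((Real.cosh t)⁻¹ * Real.tanh t)) + Real.cosh t) t := fun t => by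
    refine (((hasDerivAt_id t).mul (S1 t)).add (Real.hasDerivAt_sinh t)).congr_deriv ?_
    simp
  have Q2 : ∀ t : ℝ, HasDerivAt (fun t => (Real.cosh t)⁻¹ + t * (-((Real.cosh t)⁻¹ * Real.tanh t)) + Real.cosh t)
      ((1 ^ 2 - 2 * (1 - Real.tanh t ^ 2)) * (t * (Real.cosh t)⁻¹ + Real.sinh t)) t := fun t => by
    refine (((S1 t).add ((hasDerivAt_id t).mul (S2 t))).add (Real.hasDerivAt_cosh t)).congr_deriv ?_
    have hc := (Real.cosh_pos t).ne'
    have h2 := Real.cosh_sq t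
    simp only [id, Real.tanh_eq_sinh_div_cosh]
    field_simp
    rw [h2]; linear_combination cosh t * sinh t * h2
  obtain ⟨a, b, hab⟩ := ode_span (W := -2) (by norm_num) (k := fun t => (1 ^ 2 - 2 * (1 - Real.tanh t ^ 2))) 
     hw hw' S1 S2 Q1 Q2 (fun t => by
      have hc := (Real.cosh_pos t).ne'
      have h2 := Real.cosh_sq t
      simp only [Real.tanh_eq_sinh_div_cosh]
      field_simp
      linear_combination cosh t * h2)
  have : |b| ≤ 0 := by
    apply nonpos_of_lin (C := M + |a|)
    intro t ht
    have hc1 : (Real.cosh t)⁻¹ ≤ 1 := inv_le_one_of_one_le₀ (Real.one_le_cosh t)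
    have hc0 : 0 < (Real.cosh t)⁻¹ := inv_pos.2 (Real.cosh_pos t)
    have e1 : |b * (t * (Real.cosh t)⁻¹ + Real.sinh t)| ≤ M + |a * (Real.cosh t)⁻¹| := by
      have : b * (t * (Real.cosh t)⁻¹ + Real.sinh t) = w t - a * (Real.cosh t)⁻¹ := by
        rw [hab t]; ring
      rw [this]
      exact (abs_sub _ _).trans (by linarith [hM t])
    have e2 : |a * (Real.cosh t)⁻¹| ≤ |a| := by
      rw [abs_mul, abs_of_pos hc0]
      nlinarith [abs_nonneg a]
    have e3 : |b| * t ≤ |b * (t * (Real.cosh t)⁻¹ + Real.sinh t)| := by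
      have : t ≤ Real.sinh t := Real.self_le_sinh_iff.2 ht
      have h0 : 0 ≤ t * (Real.cosh t)⁻¹ := by positivity
      rw [abs_mul, abs_of_nonneg (a := t * (Real.cosh t)⁻¹ + Real.sinh t) (by linarith)]
      gcongr; linarith
    linarith
  have hb := abs_nonpos_iff.1 this
  exact ⟨a, fun t => by rw [hab, hb]; ring⟩

lemma mode_zero {w w' : ℝ → ℝ} {M : ℝ} (hM : ∀ t, |w t| ≤ M)
    (hw : ∀ t, HasDerivAt w (w' t) t)
    (hw' : ∀ t, HasDerivAt w' ((0 ^ 2 - 2 * (1 - Real.tanh t ^ 2)) * w t) t) :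
    ∃ a, ∀ t, w t = a * Real.tanh t := by
  have S2 : ∀ t : ℝ, HasDerivAt (fun t => 1 - Real.tanh t ^ 2) 
      ((0 ^ 2 - 2 * (1 - Real.tanh t ^ 2)) * Real.tanh t) t := fun t => by
    refine (((tanh_hd t).pow 2).const_sub 1).congr_deriv ?_
    simp; ring
  have Q1 : ∀ t : ℝ, HasDerivAt (fun t => t * Real.tanh t - 1)
      (Real.tanh t + t * (1 - Real.tanh t ^ 2)) t := fun t => by
    refine (((hasDerivAt_id t).mul (tanh_hd t)).sub_const 1).congr_deriv ?_
    simp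
  have Q2 : ∀ t : ℝ, HasDerivAt (fun t => Real.tanh t + t * (1 - Real.tanh t ^ 2))
      ((0 ^ 2 - 2 * (1 - Real.tanh t ^ 2)) * (t * Real.tanh t - 1)) t := fun t => by
    refine ((tanh_hd t).add ((hasDerivAt_id t).mul (S2 t))).congr_deriv ?_
    simp; ring
  obtain ⟨a, b, hab⟩ := ode_span (W := -1) (by norm_num) (k := fun t => (0 ^ 2 - 2 * (1 - Real.tanh t ^ 2))) 
     hw hw' tanh_hd S2 Q1 Q2 (fun t => by ring)
  have : |b| ≤ 0 := by
    apply nonpos_of_lin (C := M + |a| + |b| * 2)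
    intro t ht
    have e1 : |b * (t * Real.tanh t - 1)| ≤ M + |a * Real.tanh t| := by
      have : b * (t * Real.tanh t - 1) = w t - a * Real.tanh t := by
        rw [hab t]; ring
      rw [this]
      exact (abs_sub _ _).trans (by linarith [hM t])
    have e2 : |a * Real.tanh t| ≤ |a| := by
      rw [abs_mul]
      nlinarith [abs_nonneg a, Real.abs_tanh_lt_one t]
    have e3 : |b| * (t - 2) ≤ |b * (t * Real.tanh t - 1)| := by
      rw [abs_mul]
      gcongr
      refine le_trans ?_ (le_abs_self _)
      have hc := Real.cosh_pos t
      have h4 : t * (1 - Real.tanh t) ≤ 1 := by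
        rw [Real.tanh_eq_sinh_div_cosh]
        have : 1 - Real.sinh t / Real.cosh t = Real.exp (-t) / Real.cosh t := by
          rw [← Real.cosh_sub_sinh]; field_simp
        rw [this, ← mul_div_assoc, div_le_one hc]
        have h5 : t * Real.exp (-t) ≤ 1 := by
          have h6 : t ≤ Real.exp t := by linarith [Real.add_one_le_exp t]
          calc t * Real.exp (-t) ≤ Real.exp t * Real.exp (-t) := by gcongr
            _ = 1 := by rw [← Real.exp_add]; simp
        linarith [Real.one_le_cosh t]
      linarith
    linarith
  have hb := abs_nonpos_iff.1 this
  exact ⟨a, fun t => by rw [hab, hb]; ring⟩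

lemma fourier_three {f : ℝ → ℝ} (hf : Continuous f) (hper : Function.Periodic f (2 * π))
    (A0 Ac As : ℝ) (h0 : ∫ x in (0:ℝ)..(2 * π), f x = A0)
    (hc : ∫ x in (0:ℝ)..(2 * π), f x * Real.cos x = Ac)
    (hs : ∫ x in (0:ℝ)..(2 * π), f x * Real.sin x = As)
    (hz : ∀ n : ℕ, 2 ≤ n → (∫ x in (0:ℝ)..(2 * π), f x * Real.cos (n * x) = 0) ∧
      (∫ x in (0:ℝ)..(2 * π), f x * Real.sin (n * x) = 0)) (x : ℝ) :
    f x = A0 / (2 * π) + (Ac * Real.cos x + As * Real.sin x) / π := by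
  have : Fact (0 < 2 * π) := ⟨by positivity⟩
  have hper' : Function.Periodic (fun x => (f x : ℂ)) (2 * π) := fun x => by simp only [hper x]
  have hfc : Continuous (fun x => (f x : ℂ)) := by fun_prop
  let F : C(AddCircle (2 * π), ℂ) := ⟨hper'.lift, hfc.quotient_lift _⟩
  have hF : ∀ x : ℝ, F (x : AddCircle (2 * π)) = f x := fun x => hper'.lift_coe x
  have hexp : ∀ (n : ℤ) (x : ℝ), fourier n (x : AddCircle (2 * π)) = 
      (Real.cos (n * x) : ℂ) + (Real.sin (n * x) : ℂ) * Complex.I := by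
    intro n x
    rw [fourier_coe_apply]
    push_cast
    rw [← Complex.exp_mul_I]
    congr 1
    have : (π : ℂ) ≠ 0 := by exact_mod_cast Real.pi_ne_zero
    field_simp
  have hco : ∀ n : ℤ, fourierCoeff F n = (1 / (2 * π) : ℝ) * 
      (((∫ x in (0:ℝ)..(2 * π), f x * Real.cos (n * x) : ℝ) : ℂ) - 
       ((∫ x in (0:ℝ)..(2 * π), f x * Real.sin (n * x) : ℝ) : ℂ) * Complex.I) := by
    intro n
    rw [fourierCoeff_eq_intervalIntegral _ _ 0, zero_add, Complex.real_smul]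
    congr 1
    rw [← intervalIntegral.integral_ofReal, ← intervalIntegral.integral_ofReal,
      ← intervalIntegral.integral_mul_const, ← intervalIntegral.integral_sub]
    · refine intervalIntegral.integral_congr (fun x _ => ?_)
      simp only [hF, hexp, smul_eq_mul]
      push_cast
      rw [neg_mul, Complex.cos_neg, Complex.sin_neg]
      ring
    · exact Continuous.intervalIntegrable (by fun_prop) _ _
    · exact Continuous.intervalIntegrable (by fun_prop) _ _
  have hzero : ∀ n : ℤ, n ∉ ({-1, 0, 1} : Finset ℤ) → fourierCoeff F n = 0 := by
    intro n hn
    rw [hco]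
    have h2 : 2 ≤ n.natAbs := by
      simp at hn; omega
    obtain ⟨e1, e2⟩ := hz _ h2
    have hn3 := Int.natAbs_eq n
    generalize n.natAbs = m at *
    rcases hn3 with h | h
    · rw [h]; simp only [Int.cast_neg, Int.cast_natCast]; rw [e1, e2]; simp
    · rw [h]; simp only [Int.cast_neg, Int.cast_natCast]; simp only [neg_mul, Real.cos_neg, Real.sin_neg, mul_neg, 
        intervalIntegral.integral_neg]; rw [e1, e2]; simp
  have hsum : Summable (fourierCoeff F) := summable_of_ne_finset_zero hzero
  have hS := has_pointwise_sum_fourier_series_of_summable hsum (x : AddCircle (2 * π))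
  have hS2 := hS.unique (hasSum_sum_of_ne_finset_zero (s := {-1, 0, 1}) (fun n hn => by
    rw [hzero n hn, zero_smul]))
  rw [Finset.sum_insert (by simp), Finset.sum_insert (by simp), Finset.sum_singleton, hF] at hS2
  simp only [hco, hexp] at hS2
  simp only [Int.cast_neg, Int.cast_one, Int.cast_zero, neg_mul, one_mul, zero_mul, Real.cos_neg,
    Real.sin_neg, mul_neg, intervalIntegral.integral_neg, Real.cos_zero, Real.sin_zero, mul_one,
    mul_zero, intervalIntegral.integral_zero, hc, hs, h0] at hS2
  have := congrArg Complex.re hS2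
  simp at this
  simp only [← Complex.ofReal_cos, ← Complex.ofReal_sin, Complex.ofReal_re, Complex.ofReal_im] at this
  rw [this]
  have := Real.pi_ne_zero
  field_simp
  try ring

lemma integral_param {F F' : ℝ → ℝ → ℝ} (a b : ℝ) (hF : Continuous (Function.uncurry F))
    (hF' : Continuous (Function.uncurry F'))
    (hd : ∀ t θ, HasDerivAt (fun t => F t θ) (F' t θ) t) (t : ℝ) :
    HasDerivAt (fun t => ∫ θ in a..b, F t θ) (∫ θ in a..b, F' t θ) t := by
  obtain ⟨C, hC⟩ := ((isCompact_Icc (a := t - 1) (b := t + 1)).prod (isCompact_uIcc (a := a) (b := b))).exists_bound_of_continuousOn hF'.continuousOn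
  have cF : ∀ t, Continuous (F t) := fun t => hF.comp (by fun_prop : Continuous fun θ => (t, θ))
  have cF' : ∀ t, Continuous (F' t) := fun t => hF'.comp (by fun_prop : Continuous fun θ => (t, θ))
  refine (intervalIntegral.hasDerivAt_integral_of_dominated_loc_of_deriv_le (s := Set.Icc (t-1) (t+1))
    (bound := fun _ => C) (Icc_mem_nhds (by linarith) (by linarith))
    (Filter.Eventually.of_forall fun s => (cF s).aestronglyMeasurable)
    ((cF t).intervalIntegrable _ _) (cF' t).aestronglyMeasurable ?_ (by simp) ?_).2
  · refine Filter.Eventually.of_forall fun θ hθ s hs => hC (s, θ) ⟨hs, Set.uIoc_subset_uIcc hθ⟩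
  · exact Filter.Eventually.of_forall fun θ hθ s hs => hd s θ

lemma mode_ode {W Wt Wtt Ws Wss : ℝ → ℝ → ℝ}
    (cW : Continuous (Function.uncurry W)) (cWt : Continuous (Function.uncurry Wt))
    (cWtt : Continuous (Function.uncurry Wtt)) (cWss : Continuous (Function.uncurry Wss))
    (d1 : ∀ t θ, HasDerivAt (fun t => W t θ) (Wt t θ) t)
    (d2 : ∀ t θ, HasDerivAt (fun t => Wt t θ) (Wtt t θ) t)
    (d3 : ∀ t θ, HasDerivAt (fun θ => W t θ) (Ws t θ) θ)
    (d4 : ∀ t θ, HasDerivAt (fun θ => Ws t θ) (Wss t θ) θ)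
    (p1 : ∀ t, W t (2 * π) = W t 0) (p2 : ∀ t, Ws t (2 * π) = Ws t 0)
    (pde : ∀ t θ, Wtt t θ + Wss t θ = - (2 * (1 - Real.tanh t ^ 2)) * W t θ)
    (n : ℕ) (c : ℝ) :
    (∀ t, HasDerivAt (fun t => ∫ θ in (0:ℝ)..(2 * π), W t θ * Real.cos (n * θ + c))
      (∫ θ in (0:ℝ)..(2 * π), Wt t θ * Real.cos (n * θ + c)) t) ∧
    (∀ t, HasDerivAt (fun t => ∫ θ in (0:ℝ)..(2 * π), Wt t θ * Real.cos (n * θ + c))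
      (((n:ℝ) ^ 2 - 2 * (1 - Real.tanh t ^ 2)) *
        ∫ θ in (0:ℝ)..(2 * π), W t θ * Real.cos (n * θ + c)) t) := by
  have ce : Continuous (fun q : ℝ × ℝ => Real.cos (n * q.2 + c)) := by fun_prop
  have sl : ∀ {G : ℝ → ℝ → ℝ} (_ : Continuous (Function.uncurry G)) (t : ℝ), Continuous (G t) :=
    fun hG t => hG.comp (by fun_prop : Continuous fun θ => (t, θ))
  refine ⟨integral_param (F := fun t θ => W t θ * Real.cos (n * θ + c))
    (F' := fun t θ => Wt t θ * Real.cos (n * θ + c)) 0 (2 * π) (cW.mul ce) (cWt.mul ce)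
    (fun t θ => (d1 t θ).mul_const _), fun t => ?_⟩
  refine (integral_param (F := fun t θ => Wt t θ * Real.cos (n * θ + c))
    (F' := fun t θ => Wtt t θ * Real.cos (n * θ + c)) 0 (2 * π) (cWt.mul ce) (cWtt.mul ce)
    (fun t θ => (d2 t θ).mul_const _) t).congr_deriv ?_
  have hlin : ∀ θ : ℝ, HasDerivAt (fun θ : ℝ => (n:ℝ) * θ + c) n θ := fun θ => by
    simpa using ((hasDerivAt_id θ).const_mul (n:ℝ)).add_const c
  have hparts : ∫ θ in (0:ℝ)..(2 * π), (Wss t θ * Real.cos (n * θ + c) +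
      (n:ℝ) ^ 2 * (W t θ * Real.cos (n * θ + c))) = 0 := by
    rw [intervalIntegral.integral_eq_sub_of_hasDerivAt
      (f := fun θ => Ws t θ * Real.cos (n * θ + c) + W t θ * (n * Real.sin (n * θ + c)))]
    · have e1 : Real.cos (n * (2 * π) + c) = Real.cos c := by
        rw [add_comm, Real.cos_add_nat_mul_two_pi]
      have e2 : Real.sin (n * (2 * π) + c) = Real.sin c := by
        rw [add_comm, Real.sin_add_nat_mul_two_pi]
      rw [e1, e2, p1, p2]; simp
    · intro θ _
      refine (((d4 t θ).mul (hlin θ).cos).add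
        ((d3 t θ).mul ((hlin θ).sin.const_mul (n:ℝ)))).congr_deriv ?_
      ring
    · have := sl cW t
      have := sl cWss t
      exact Continuous.intervalIntegrable (by fun_prop) _ _
  rw [← intervalIntegral.integral_const_mul]
  refine (add_zero _).symm.trans ((congrArg _ hparts.symm).trans ?_)
  rw [← intervalIntegral.integral_add]
  · refine intervalIntegral.integral_congr fun θ _ => ?_
    have := pde t θ
    linear_combination Real.cos (n * θ + c) * this
  · have := sl cWtt t
    exact Continuous.intervalIntegrable (by fun_prop) _ _
  · have := sl cW t
    have := sl cWss t
    exact Continuous.intervalIntegrable (by fun_prop) _ _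

lemma cylinder {W Wt Wtt Ws Wss : ℝ → ℝ → ℝ}
    (cW : Continuous (Function.uncurry W)) (cWt : Continuous (Function.uncurry Wt))
    (cWtt : Continuous (Function.uncurry Wtt)) (cWss : Continuous (Function.uncurry Wss))
    (d1 : ∀ t θ, HasDerivAt (fun t => W t θ) (Wt t θ) t)
    (d2 : ∀ t θ, HasDerivAt (fun t => Wt t θ) (Wtt t θ) t)
    (d3 : ∀ t θ, HasDerivAt (fun θ => W t θ) (Ws t θ) θ)
    (d4 : ∀ t θ, HasDerivAt (fun θ => Ws t θ) (Wss t θ) θ)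
    (p1 : ∀ t θ, W t (θ + 2 * π) = W t θ) (p2 : ∀ t, Ws t (2 * π) = Ws t 0)
    (pde : ∀ t θ, Wtt t θ + Wss t θ = - (2 * (1 - Real.tanh t ^ 2)) * W t θ)
    {M : ℝ} (hM : ∀ t θ, |W t θ| ≤ M) :
    ∃ A B C : ℝ, ∀ t θ, W t θ = A * (Real.cosh t)⁻¹ * Real.cos θ +
      B * (Real.cosh t)⁻¹ * Real.sin θ + C * Real.tanh t := by
  have ode := mode_ode cW cWt cWtt cWss d1 d2 d3 d4 (fun t => by simpa using p1 t 0) p2 pde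
  have bd : ∀ (n : ℕ) (c t : ℝ), |∫ θ in (0:ℝ)..(2 * π), W t θ * Real.cos (n * θ + c)|
      ≤ M * |2 * π - 0| := by
    intro n c t
    rw [← Real.norm_eq_abs]
    refine intervalIntegral.norm_integral_le_of_norm_le_const fun θ _ => ?_
    rw [Real.norm_eq_abs, abs_mul]
    have h1 := hM t θ
    have h2 := Real.abs_cos_le_one (n * θ + c)
    have h3 := abs_nonneg (W t θ)
    nlinarith
  have hsin : ∀ y : ℝ, Real.cos (y + -(π / 2)) = Real.sin y := fun y => by
    rw [← sub_eq_add_neg, Real.cos_sub_pi_div_two]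
  obtain ⟨C, hC⟩ := mode_zero (bd 0 0) (ode 0 0).1 (by simpa using (ode 0 0).2)
  obtain ⟨A, hA⟩ := mode_one (bd 1 0) (ode 1 0).1 (by simpa using (ode 1 0).2)
  obtain ⟨B, hB⟩ := mode_one (bd 1 (-(π/2))) (ode 1 (-(π/2))).1 (by simpa using (ode 1 (-(π/2))).2)
  simp only [hsin] at hB
  refine ⟨A / π, B / π, C / (2 * π), fun t θ => ?_⟩
  rw [fourier_three (f := W t) (cW.comp (by fun_prop : Continuous fun θ => (t, θ))) (p1 t)
    (C * Real.tanh t) (A * (Real.cosh t)⁻¹) (B * (Real.cosh t)⁻¹) (by simpa using hC t)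
    (by simpa using hA t) (by simpa using hB t) (fun n hn => ?_) θ]
  · ring
  · have hn' : (2:ℝ) ≤ n := by exact_mod_cast hn
    have h1 := mode_ge_two hn' (bd n 0) (ode n 0).1 (ode n 0).2 t
    have h2 := mode_ge_two hn' (bd n (-(π/2))) (ode n (-(π/2))).1 (ode n (-(π/2))).2 t
    simp only [hsin] at h2
    simp only [add_zero] at h1
    exact ⟨h1, h2⟩

/-- The point of the plane with coordinates `x`, `y`. -/
noncomputable def pt (x y : ℝ) : EuclideanSpace ℝ (Fin 2) :=
  x • EuclideanSpace.single 0 1 + y • EuclideanSpace.single 1 1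

lemma pt_zero (x y : ℝ) : pt x y 0 = x := by simp [pt]
lemma pt_one (x y : ℝ) : pt x y 1 = y := by simp [pt]

lemma pt_eta (z : EuclideanSpace ℝ (Fin 2)) : pt (z 0) (z 1) = z := by
  ext i; fin_cases i <;> simp [pt]

lemma pt_norm (x y : ℝ) : ‖pt x y‖ ^ 2 = x ^ 2 + y ^ 2 := by
  rw [EuclideanSpace.norm_sq_eq]; simp [pt_zero, pt_one]

lemma pt_chain {u : EuclideanSpace ℝ (Fin 2) → ℝ} (hu : Differentiable ℝ u) {X Y : ℝ → ℝ}
    {X' Y' s : ℝ} (hX : HasDerivAt X X' s) (hY : HasDerivAt Y Y' s) :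
    HasDerivAt (fun s => u (pt (X s) (Y s)))
      (X' * fderiv ℝ u (pt (X s) (Y s)) (EuclideanSpace.single 0 1) +
       Y' * fderiv ℝ u (pt (X s) (Y s)) (EuclideanSpace.single 1 1)) s := by
  have h : HasDerivAt (fun s => pt (X s) (Y s)) (X' • EuclideanSpace.single 0 1 + Y' • EuclideanSpace.single 1 1) s :=
    (hX.smul_const _).add (hY.smul_const _)
  refine ((hu _).hasFDerivAt.comp_hasDerivAt s h).congr_deriv ?_
  simp

/-- classification of bounded solutions of the linearized Liouville equation
`-Δv = (1 + |x|²/8)^{-2} v` in `ℝ²`. -/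
theorem stmt9 (v : EuclideanSpace ℝ (Fin 2) → ℝ)
    (hv : ContDiff ℝ 2 v) (hbdd : ∃ M : ℝ, ∀ x, |v x| ≤ M)
    (heq : ∀ x : EuclideanSpace ℝ (Fin 2),
      -lap v x = ((1 + ‖x‖ ^ 2 / 8) ^ 2)⁻¹ * v x) :
    ∃ a₁ a₂ b : ℝ, ∀ x : EuclideanSpace ℝ (Fin 2),
      v x = a₁ * (x 0) / (1 + ‖x‖ ^ 2 / 8) + a₂ * (x 1) / (1 + ‖x‖ ^ 2 / 8) +
        b * (8 - ‖x‖ ^ 2) / (8 + ‖x‖ ^ 2) := by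
  obtain ⟨M, hM⟩ := hbdd
  have hD : ∀ e, ContDiff ℝ 1 (fun y => fderiv ℝ v y e) := fun e =>
    (hv.fderiv_right (m := 1) (by norm_num)).clm_apply contDiff_const
  have hDD : ∀ e f, Continuous (fun y => fderiv ℝ (fun y => fderiv ℝ v y e) y f) := fun e f =>
    ((hD e).continuous_fderiv (by norm_num)).clm_apply continuous_const
  set e0 : EuclideanSpace ℝ (Fin 2) := EuclideanSpace.single 0 1 with he0
  set e1 : EuclideanSpace ℝ (Fin 2) := EuclideanSpace.single 1 1 with he1
  set vx := fun y => fderiv ℝ v y e0 with hvx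
  set vy := fun y => fderiv ℝ v y e1 with hvy
  have dv : Differentiable ℝ v := hv.differentiable (by norm_num)
  have dvx : Differentiable ℝ vx := (hD e0).differentiable (by norm_num)
  have dvy : Differentiable ℝ vy := (hD e1).differentiable (by norm_num)
  have cvx : Continuous vx := (hD e0).continuous
  have cvy : Continuous vy := (hD e1).continuous
  have cxx : Continuous (fun y => fderiv ℝ vx y e0) := hDD e0 e0
  have cxy : Continuous (fun y => fderiv ℝ vx y e1) := hDD e0 e1
  have cyx : Continuous (fun y => fderiv ℝ vy y e0) := hDD e1 e0
  have cyy : Continuous (fun y => fderiv ℝ vy y e1) := hDD e1 e1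
  have hlap : ∀ y, lap v y = fderiv ℝ vx y e0 + fderiv ℝ vy y e1 := fun y => by
    simp [lap, hvx, hvy, he0, he1]
  have hs8 : √8 ^ 2 = (8:ℝ) := Real.sq_sqrt (by norm_num)
  obtain ⟨X, hX⟩ : ∃ X : ℝ → ℝ → ℝ, X = fun t θ => √8 * Real.exp t * Real.cos θ := ⟨_, rfl⟩
  obtain ⟨Y, hY⟩ : ∃ Y : ℝ → ℝ → ℝ, Y = fun t θ => √8 * Real.exp t * Real.sin θ := ⟨_, rfl⟩
  have Xt : ∀ t θ, HasDerivAt (fun t => X t θ) (X t θ) t := fun t θ => by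
    rw [hX]; exact ((Real.hasDerivAt_exp t).const_mul _).mul_const _
  have Yt : ∀ t θ, HasDerivAt (fun t => Y t θ) (Y t θ) t := fun t θ => by
    rw [hY]; exact ((Real.hasDerivAt_exp t).const_mul _).mul_const _
  have Xs : ∀ t θ, HasDerivAt (fun θ => X t θ) (-Y t θ) θ := fun t θ => by
    rw [hX, hY]; exact ((Real.hasDerivAt_cos θ).const_mul _).congr_deriv (by ring)
  have Ys : ∀ t θ, HasDerivAt (fun θ => Y t θ) (X t θ) θ := fun t θ => by
    rw [hX, hY]; exact (Real.hasDerivAt_sin θ).const_mul _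
  have hR : ∀ t θ, X t θ ^ 2 + Y t θ ^ 2 = 8 * Real.exp t ^ 2 := fun t θ => by
    rw [hX, hY]
    linear_combination √8 ^ 2 * Real.exp t ^ 2 * Real.cos_sq_add_sin_sq θ + Real.exp t ^ 2 * hs8
  have cX : Continuous (fun q : ℝ × ℝ => X q.1 q.2) := by rw [hX]; fun_prop
  have cY : Continuous (fun q : ℝ × ℝ => Y q.1 q.2) := by rw [hY]; fun_prop
  have cE : Continuous (fun q : ℝ × ℝ => pt (X q.1 q.2) (Y q.1 q.2)) := by unfold pt; fun_prop
  have Xp : ∀ t θ, X t (θ + 2 * π) = X t θ := fun t θ => by rw [hX]; simp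
  have Yp : ∀ t θ, Y t (θ + 2 * π) = Y t θ := fun t θ => by rw [hY]; simp
  have ch : ∀ t : ℝ, Real.cosh t = (1 + Real.exp t ^ 2) / (2 * Real.exp t) := fun t => by
    rw [Real.cosh_eq, Real.exp_neg]; field_simp; ring
  have th : ∀ t : ℝ, Real.tanh t = (Real.exp t ^ 2 - 1) / (1 + Real.exp t ^ 2) := fun t => by
    rw [Real.tanh_eq_sinh_div_cosh, ch, Real.sinh_eq, Real.exp_neg]; field_simp
  obtain ⟨A, B, C, hABC⟩ := cylinder (W := fun t θ => v (pt (X t θ) (Y t θ)))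
    (Wt := fun t θ => X t θ * vx (pt (X t θ) (Y t θ)) + Y t θ * vy (pt (X t θ) (Y t θ)))
    (Wtt := fun t θ => (X t θ * vx (pt (X t θ) (Y t θ)) +
        X t θ * (X t θ * fderiv ℝ vx (pt (X t θ) (Y t θ)) e0 + Y t θ * fderiv ℝ vx (pt (X t θ) (Y t θ)) e1)) +
      (Y t θ * vy (pt (X t θ) (Y t θ)) +
        Y t θ * (X t θ * fderiv ℝ vy (pt (X t θ) (Y t θ)) e0 + Y t θ * fderiv ℝ vy (pt (X t θ) (Y t θ)) e1)))
    (Ws := fun t θ => -Y t θ * vx (pt (X t θ) (Y t θ)) + X t θ * vy (pt (X t θ) (Y t θ)))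
    (Wss := fun t θ => (-X t θ * vx (pt (X t θ) (Y t θ)) +
        -Y t θ * (-Y t θ * fderiv ℝ vx (pt (X t θ) (Y t θ)) e0 + X t θ * fderiv ℝ vx (pt (X t θ) (Y t θ)) e1)) +
      (-Y t θ * vy (pt (X t θ) (Y t θ)) +
        X t θ * (-Y t θ * fderiv ℝ vy (pt (X t θ) (Y t θ)) e0 + X t θ * fderiv ℝ vy (pt (X t θ) (Y t θ)) e1)))
    (hv.continuous.comp cE)
    ((cX.mul (cvx.comp cE)).add (cY.mul (cvy.comp cE)))
    (((cX.mul (cvx.comp cE)).add (cX.mul ((cX.mul (cxx.comp cE)).add (cY.mul (cxy.comp cE))))).add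
     ((cY.mul (cvy.comp cE)).add (cY.mul ((cX.mul (cyx.comp cE)).add (cY.mul (cyy.comp cE))))))
    (((cX.neg.mul (cvx.comp cE)).add (cY.neg.mul ((cY.neg.mul (cxx.comp cE)).add (cX.mul (cxy.comp cE))))).add
     ((cY.neg.mul (cvy.comp cE)).add (cX.mul ((cY.neg.mul (cyx.comp cE)).add (cX.mul (cyy.comp cE))))))
    (fun t θ => pt_chain dv (Xt t θ) (Yt t θ))
    (fun t θ => ((Xt t θ).mul (pt_chain dvx (Xt t θ) (Yt t θ))).add
      ((Yt t θ).mul (pt_chain dvy (Xt t θ) (Yt t θ))))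
    (fun t θ => pt_chain dv (Xs t θ) (Ys t θ))
    (fun t θ => ((Ys t θ).neg.mul (pt_chain dvx (Xs t θ) (Ys t θ))).add
      ((Xs t θ).mul (pt_chain dvy (Xs t θ) (Ys t θ))))
    (fun t θ => by simp only [Xp, Yp])
    (fun t => by
      have h1 := Xp t 0
      have h2 := Yp t 0
      rw [zero_add] at h1 h2
      simp only [h1, h2])
    (fun t θ => by
      have h := heq (pt (X t θ) (Y t θ))
      rw [hlap, pt_norm, hR] at h
      have h2 : 2 * (1 - Real.tanh t ^ 2) = 8 * Real.exp t ^ 2 * ((1 + 8 * Real.exp t ^ 2 / 8) ^ 2)⁻¹ := by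
        rw [th]
        have : 1 + Real.exp t ^ 2 ≠ 0 := by positivity
        field_simp
        ring
      rw [h2]
      have hr := hR t θ
      linear_combination (-8 * Real.exp t ^ 2) * h + (fderiv ℝ vx (pt (X t θ) (Y t θ)) e0 +
        fderiv ℝ vy (pt (X t θ) (Y t θ)) e1) * hr)
    (fun t θ => hM _)
  refine ⟨A / √2, B / √2, -C, fun x => ?_⟩
  have hcont : Continuous (fun x : EuclideanSpace ℝ (Fin 2) =>
      A / √2 * (x 0) / (1 + ‖x‖ ^ 2 / 8) + B / √2 * (x 1) / (1 + ‖x‖ ^ 2 / 8) +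
        -C * (8 - ‖x‖ ^ 2) / (8 + ‖x‖ ^ 2)) := by
    have h1 : ∀ x : EuclideanSpace ℝ (Fin 2), 1 + ‖x‖ ^ 2 / 8 ≠ 0 := fun x => by positivity
    have h2 : ∀ x : EuclideanSpace ℝ (Fin 2), 8 + ‖x‖ ^ 2 ≠ 0 := fun x => by positivity
    fun_prop (disch := assumption)
  refine congrFun (Continuous.ext_on (dense_compl_singleton (0 : EuclideanSpace ℝ (Fin 2)))
    hv.continuous hcont ?_) x
  intro z hz
  have hz' : z ≠ 0 := hz
  have hn : 0 < ‖z‖ := norm_pos_iff.2 hz'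
  set ζ : ℂ := ⟨z 0, z 1⟩ with hζ
  have hnz : ‖ζ‖ = ‖z‖ := by
    have h1 : ‖ζ‖ ^ 2 = ‖z‖ ^ 2 := by
      rw [← Complex.normSq_eq_norm_sq, EuclideanSpace.norm_sq_eq, Complex.normSq_apply]
      simp [hζ, sq]
    exact (sq_eq_sq₀ (norm_nonneg _) hn.le).1 h1
  obtain ⟨t, ht⟩ : ∃ t, √8 * Real.exp t = ‖z‖ := ⟨Real.log (‖z‖ / √8), by
    rw [Real.exp_log (by positivity)]; field_simp⟩
  have hz0 : z 0 = X t ζ.arg := by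
    rw [hX]; simp only [ht]; rw [← hnz, Complex.norm_mul_cos_arg]
  have hz1 : z 1 = Y t ζ.arg := by
    rw [hY]; simp only [ht]; rw [← hnz, Complex.norm_mul_sin_arg]
  have hzz : ‖z‖ ^ 2 = 8 * Real.exp t ^ 2 := by rw [← ht, mul_pow, hs8]
  have hvz : v z = v (pt (X t ζ.arg) (Y t ζ.arg)) := by rw [← hz0, ← hz1, pt_eta]
  simp only
  rw [hvz, hABC, hzz, hz0, hz1, hX, hY, th, ch]
  have h8 : √8 = 2 * √2 := by
    rw [show (8:ℝ) = 2 ^ 2 * 2 by norm_num, Real.sqrt_mul (by norm_num), Real.sqrt_sq (by norm_num)]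
  simp only [h8]
  have : 1 + Real.exp t ^ 2 ≠ 0 := by positivity
  have e8 : 8 + 8 * Real.exp t ^ 2 = 8 * (1 + Real.exp t ^ 2) := by ring
  have e9 : 1 + 8 * Real.exp t ^ 2 / 8 = 1 + Real.exp t ^ 2 := by ring
  rw [e8, e9]
  field_simp
  ring
end

section
/- Let Ω ⊂ ℝⁿ be a bounded convex smooth domain, p > 1, λ ∈ ℝ with λ ≥ 0, and let u ∈ C³(Ω) ∩ C¹(Ω̄) satisfy -Δu + λu = u^p, u > 0 in Ω, u = 0 on ∂Ω. Let x₀ be a maximum point of u and suppose there exists an open set W ⊂ Ω containing x₀ such that: (i) (x - x₀)·∇u(x) < 0 for all x ∈ W \ {x₀}; (ii) (x - x₀)·∇u(x) + (2/(p-1))u(x) < 0 for all x ∈ ∂W; (iii) the first eigenvalue of -Δ - p u^{p-1} on H¹₀(Ω \ W̄) is positive. Then (x - x₀)·∇u(x) < 0 for all x ∈ Ω \ {x₀}; in particular x₀ is the unique critical point of u in Ω. -/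
open MeasureTheory Real
open scoped RealInnerProductSpace

noncomputable def lapn (n : ℕ) (u : EuclideanSpace ℝ (Fin n) → ℝ)
    (x : EuclideanSpace ℝ (Fin n)) : ℝ :=
  ∑ i : Fin n, fderiv ℝ (fun y => fderiv ℝ u y (EuclideanSpace.single i 1)) x
    (EuclideanSpace.single i 1)

open Filter Topology

lemma aux_norm_gradient {n : ℕ} (f : EuclideanSpace ℝ (Fin n) → ℝ) (x : EuclideanSpace ℝ (Fin n)) :
    ‖gradient f x‖ = ‖fderiv ℝ f x‖ := by
  simp [gradient]

lemma aux_inner_gradient {n : ℕ} (f : EuclideanSpace ℝ (Fin n) → ℝ)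
    (x v : EuclideanSpace ℝ (Fin n)) :
    ⟪v, gradient f x⟫ = fderiv ℝ f x v := by
  rw [real_inner_comm]
  exact InnerProductSpace.toDual_symm_apply

lemma aux_norm_sq_gradient {n : ℕ} (f : EuclideanSpace ℝ (Fin n) → ℝ)
    (x : EuclideanSpace ℝ (Fin n)) :
    ‖gradient f x‖ ^ 2 = ∑ i : Fin n, (fderiv ℝ f x (EuclideanSpace.single i 1)) ^ 2 := by
  rw [← (EuclideanSpace.basisFun (Fin n) ℝ).sum_sq_norm_inner_right]
  refine Finset.sum_congr rfl fun i _ => ?_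
  rw [aux_inner_gradient]
  simp

/-- The inequality for smooth test functions extends to `C¹` test functions. -/
lemma aux_test_C1 {n : ℕ} {U : Set (EuclideanSpace ℝ (Fin n))}
    (hU : IsOpen U) (hUb : Bornology.IsBounded U)
    {c : EuclideanSpace ℝ (Fin n) → ℝ} (hc : ContinuousOn c U) {M : ℝ}
    (hM : ∀ x ∈ U, |c x| ≤ M) {μ : ℝ}
    (H : ∀ φ : EuclideanSpace ℝ (Fin n) → ℝ,
      ContDiff ℝ (⊤ : ℕ∞) φ → HasCompactSupport φ → tsupport φ ⊆ U →
      μ * ∫ x in U, (φ x) ^ 2 ≤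
        (∫ x in U, ‖gradient φ x‖ ^ 2) - ∫ x in U, c x * (φ x) ^ 2)
    {φ : EuclideanSpace ℝ (Fin n) → ℝ} (hφ : ContDiff ℝ 1 φ) (hcs : HasCompactSupport φ)
    (hsub : tsupport φ ⊆ U) :
    μ * ∫ x in U, (φ x) ^ 2 ≤
        (∫ x in U, ‖gradient φ x‖ ^ 2) - ∫ x in U, c x * (φ x) ^ 2 := by
  simp_rw [aux_norm_gradient] at H ⊢
  obtain ⟨δ, hδ, hδU⟩ := hcs.isCompact.exists_cthickening_subset_open hU hsub
  let b : ℕ → ContDiffBump (0 : EuclideanSpace ℝ (Fin n)) := fun k =>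
    ⟨δ / 2 / (k + 1), δ / (k + 1), by positivity, by
      apply div_lt_div_of_pos_right (by linarith) (by positivity)⟩
  have hrOut : ∀ k, (b k).rOut = δ / (k + 1) := fun k => rfl
  have hr : Tendsto (fun k => (b k).rOut) atTop (𝓝 0) := by
    simp_rw [hrOut]
    have := (tendsto_one_div_add_atTop_nhds_zero_nat (𝕜 := ℝ)).const_mul δ
    simpa [div_eq_mul_inv] using this
  have hrle : ∀ k, (b k).rOut ≤ δ := fun k => by
    rw [hrOut]; apply div_le_self hδ.le; norm_cast; omega
  let Φ : ℕ → EuclideanSpace ℝ (Fin n) → ℝ := fun k =>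
    MeasureTheory.convolution ((b k).normed volume) φ (ContinuousLinearMap.lsmul ℝ ℝ) volume
  have hφc := hφ.continuous
  have hdc : Continuous (fderiv ℝ φ) := hφ.continuous_fderiv one_ne_zero
  have hΦsm : ∀ k, ContDiff ℝ (⊤ : ℕ∞) (Φ k) := fun k =>
    (b k).hasCompactSupport_normed.contDiff_convolution_left _ (b k).contDiff_normed
      hφc.locallyIntegrable
  have hΦcs : ∀ k, HasCompactSupport (Φ k) := fun k =>
    (b k).hasCompactSupport_normed.convolution _ hcs
  have hΦsub : ∀ k, tsupport (Φ k) ⊆ U := by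
    intro k
    refine Set.Subset.trans ?_ hδU
    refine closure_minimal ?_ Metric.isClosed_cthickening
    refine (MeasureTheory.support_convolution_subset_swap _).trans ?_
    rintro x ⟨y, hy, z, hz, rfl⟩
    rw [(b k).support_normed_eq, mem_ball_zero_iff] at hz
    refine Metric.mem_cthickening_of_dist_le _ y _ _ (subset_tsupport _ hy) ?_
    simpa [dist_eq_norm] using hz.le.trans (hrle k)
  have hΦd : ∀ k x, fderiv ℝ (Φ k) x =
      MeasureTheory.convolution ((b k).normed volume) (fderiv ℝ φ)
        (ContinuousLinearMap.lsmul ℝ ℝ) volume x := by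
    intro k x
    have := (hcs.hasFDerivAt_convolution_right (ContinuousLinearMap.lsmul ℝ ℝ)
      ((b k).continuous_normed (μ := volume)).locallyIntegrable hφ x (μ := volume)).fderiv
    rw [this]
    rfl
  obtain ⟨A, hA⟩ := hcs.exists_bound_of_continuous hφc
  obtain ⟨A', hA'⟩ := (hcs.fderiv (𝕜 := ℝ)).exists_bound_of_continuous hdc
  have hA0 : 0 ≤ A := (norm_nonneg _).trans (hA 0)
  have hA0' : 0 ≤ A' := (norm_nonneg _).trans (hA' 0)
  have hbd : ∀ k x, ‖Φ k x‖ ≤ A := by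
    intro k x
    have := dist_convolution_le (μ := volume) (z₀ := (0 : ℝ)) (x₀ := x) hA0
      ((b k).support_normed_eq (μ := volume)).subset
      (b k).nonneg_normed (b k).integral_normed hφc.aestronglyMeasurable
      (fun y _ => by simpa using hA y)
    simpa using this
  have hbd' : ∀ k x, ‖fderiv ℝ (Φ k) x‖ ≤ A' := by
    intro k x
    rw [hΦd]
    have := dist_convolution_le (μ := volume) (z₀ := (0 : EuclideanSpace ℝ (Fin n) →L[ℝ] ℝ))
      (x₀ := x) hA0'
      ((b k).support_normed_eq (μ := volume)).subset
      (b k).nonneg_normed (b k).integral_normed hdc.aestronglyMeasurable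
      (fun y _ => by simpa using hA' y)
    simpa using this
  have ht : ∀ x, Tendsto (fun k => Φ k x) atTop (𝓝 (φ x)) := fun x =>
    ContDiffBump.convolution_tendsto_right_of_continuous hr hφc x
  have ht' : ∀ x, Tendsto (fun k => fderiv ℝ (Φ k) x) atTop (𝓝 (fderiv ℝ φ x)) := fun x => by
    simp_rw [hΦd]
    exact ContDiffBump.convolution_tendsto_right_of_continuous hr hdc x
  have hfin : volume U ≠ ⊤ := hUb.measure_lt_top.ne
  have hfin' : IsFiniteMeasure (volume.restrict U) := ⟨by simpa using hUb.measure_lt_top⟩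
  have hmem : ∀ᵐ x ∂(volume.restrict U), x ∈ U := ae_restrict_mem hU.measurableSet
  have hcm : AEStronglyMeasurable c (volume.restrict U) :=
    hc.aestronglyMeasurable hU.measurableSet
  have T1 : Tendsto (fun k => ∫ x in U, (Φ k x) ^ 2) atTop (𝓝 (∫ x in U, (φ x) ^ 2)) := by
    refine tendsto_integral_of_dominated_convergence (fun _ => A ^ 2) (fun k => ?_)
      (integrable_const _) (fun k => ?_) ?_
    · exact ((hΦsm k).continuous.pow 2).aestronglyMeasurable
    · refine Eventually.of_forall fun x => ?_
      rw [norm_pow]; gcongr; exact hbd k x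
    · exact Eventually.of_forall fun x => (ht x).pow 2
  have T2 : Tendsto (fun k => ∫ x in U, ‖fderiv ℝ (Φ k) x‖ ^ 2) atTop
      (𝓝 (∫ x in U, ‖fderiv ℝ φ x‖ ^ 2)) := by
    refine tendsto_integral_of_dominated_convergence (fun _ => A' ^ 2) (fun k => ?_)
      (integrable_const _) (fun k => ?_) ?_
    · exact (((hΦsm k).continuous_fderiv (by simp)).norm.pow 2).aestronglyMeasurable
    · refine Eventually.of_forall fun x => ?_
      rw [norm_pow, norm_norm]; gcongr; exact hbd' k x
    · exact Eventually.of_forall fun x => (ht' x).norm.pow 2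
  have T3 : Tendsto (fun k => ∫ x in U, c x * (Φ k x) ^ 2) atTop
      (𝓝 (∫ x in U, c x * (φ x) ^ 2)) := by
    refine tendsto_integral_of_dominated_convergence (fun _ => M * A ^ 2) (fun k => ?_)
      (integrable_const _) (fun k => ?_) ?_
    · exact hcm.mul ((hΦsm k).continuous.pow 2).aestronglyMeasurable
    · filter_upwards [hmem] with x hx
      rw [norm_mul, norm_pow]
      have h1 := hM x hx
      have h2 := hbd k x
      have : 0 ≤ M := (abs_nonneg _).trans h1
      gcongr
      exact h1
    · exact Eventually.of_forall fun x => ((ht x).pow 2).const_mul _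
  exact le_of_tendsto_of_tendsto' (T1.const_mul μ) (T2.sub T3)
    (fun k => H (Φ k) (hΦsm k) (hΦcs k) (hΦsub k))

lemma aux_pw_hasDerivAt {q : ℝ} (hq : 1 < q) (s : ℝ) :
    HasDerivAt (fun s : ℝ => (max s 0) ^ q) (q * (max s 0) ^ (q - 1)) s := by
  rcases lt_trichotomy s 0 with h | h | h
  · rw [max_eq_right h.le, Real.zero_rpow (by linarith), mul_zero]
    refine (hasDerivAt_const s (0 : ℝ)).congr_of_eventuallyEq ?_
    filter_upwards [Iio_mem_nhds h] with y hy
    rw [max_eq_right (le_of_lt hy), Real.zero_rpow (by linarith)]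
  · subst h
    rw [max_self, Real.zero_rpow (by linarith), mul_zero]
    rw [← hasDerivWithinAt_univ, ← Set.Iic_union_Ici (a := (0 : ℝ))]
    refine HasDerivWithinAt.union ?_ ?_
    · refine (hasDerivWithinAt_const (0 : ℝ) (Set.Iic 0) (0 : ℝ)).congr ?_ ?_
      · intro y hy
        rw [max_eq_right hy, Real.zero_rpow (by linarith)]
      · simp [Real.zero_rpow (by linarith : q ≠ 0)]
    · have := (Real.hasDerivAt_rpow_const (x := 0) (p := q) (Or.inr hq.le)).hasDerivWithinAt
        (s := Set.Ici 0)
      rw [Real.zero_rpow (by linarith), mul_zero] at this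
      refine this.congr ?_ ?_
      · intro y hy
        rw [max_eq_left hy]
      · simp
  · rw [max_eq_left h.le]
    refine (Real.hasDerivAt_rpow_const (x := s) (p := q) (Or.inr hq.le)).congr_of_eventuallyEq ?_
    filter_upwards [Ioi_mem_nhds h] with y hy
    rw [max_eq_left (le_of_lt hy)]

lemma aux_pw_contDiff {q : ℝ} (hq : 1 < q) : ContDiff ℝ 1 (fun s : ℝ => (max s 0) ^ q) := by
  rw [contDiff_one_iff_deriv]
  refine ⟨fun s => (aux_pw_hasDerivAt hq s).differentiableAt, ?_⟩
  have : deriv (fun s : ℝ => (max s 0) ^ q) = fun s => q * (max s 0) ^ (q - 1) :=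
    funext fun s => (aux_pw_hasDerivAt hq s).deriv
  rw [this]
  refine continuous_const.mul ?_
  exact (continuous_id.max continuous_const).rpow_const (fun _ => Or.inr (by linarith))
lemma aux_integrable_cpt {n : ℕ} {U K : Set (EuclideanSpace ℝ (Fin n))}
    (hK : IsCompact K) (hKU : K ⊆ U) {g : EuclideanSpace ℝ (Fin n) → ℝ}
    (hg : ContinuousOn g U) (hs : ∀ x, x ∉ K → g x = 0) : Integrable g := by
  refine (integrableOn_iff_integrable_of_support_subset (s := K) ?_).1
    ((hg.mono hKU).integrableOn_compact hK)
  intro x hx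
  by_contra h
  exact hx (hs x h)

lemma aux_cut {n : ℕ} {U : Set (EuclideanSpace ℝ (Fin n))}
    (hU : IsOpen U) {w : EuclideanSpace ℝ (Fin n) → ℝ} (hw : ContDiffOn ℝ 2 w U) {η : ℝ}
    (hK : IsCompact {x ∈ U | η ≤ w x}) {q : ℝ} (hq : 1 < q) :
    ContDiff ℝ 1 (U.indicator (fun x => (max (w x - η) 0) ^ q)) ∧
    HasCompactSupport (U.indicator (fun x => (max (w x - η) 0) ^ q)) ∧
    tsupport (U.indicator (fun x => (max (w x - η) 0) ^ q)) ⊆ {x ∈ U | η ≤ w x} ∧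
    ∀ x ∈ U, fderiv ℝ (U.indicator (fun x => (max (w x - η) 0) ^ q)) x =
      (q * (max (w x - η) 0) ^ (q - 1)) • fderiv ℝ w x := by
  have hsupp : ∀ x, x ∉ {x ∈ U | η ≤ w x} →
      U.indicator (fun x => (max (w x - η) 0) ^ q) x = 0 := by
    intro x hx
    by_cases hxU : x ∈ U
    · rw [Set.indicator_of_mem hxU]
      have : w x < η := by
        by_contra h
        exact hx ⟨hxU, not_lt.1 h⟩
      rw [max_eq_right (by linarith), Real.zero_rpow (by linarith)]
    · exact Set.indicator_of_notMem hxU _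
  have hts : tsupport (U.indicator (fun x => (max (w x - η) 0) ^ q)) ⊆ {x ∈ U | η ≤ w x} := by
    refine closure_minimal ?_ hK.isClosed
    intro x hx
    by_contra h
    exact hx (hsupp x h)
  have hev : ∀ x ∈ U, U.indicator (fun x => (max (w x - η) 0) ^ q) =ᶠ[𝓝 x]
      (fun s : ℝ => (max s 0) ^ q) ∘ (fun x => w x - η) := by
    intro x hx
    filter_upwards [hU.mem_nhds hx] with y hy
    rw [Set.indicator_of_mem hy]; rfl
  refine ⟨?_, ?_, hts, ?_⟩
  · rw [contDiff_iff_contDiffAt]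
    intro x
    by_cases hx : x ∈ U
    · refine ContDiffAt.congr_of_eventuallyEq ?_ (hev x hx)
      refine (aux_pw_contDiff hq).contDiffAt.comp x ?_
      exact (((hw x hx).contDiffAt (hU.mem_nhds hx)).of_le (by norm_num)).sub contDiffAt_const
    · have hx' : x ∉ {x ∈ U | η ≤ w x} := fun h => hx h.1
      refine (contDiffAt_const (c := (0 : ℝ))).congr_of_eventuallyEq ?_
      filter_upwards [hK.isClosed.isOpen_compl.mem_nhds hx'] with y hy
      exact hsupp y hy
  · exact HasCompactSupport.intro hK hsupp
  · intro x hx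
    rw [(hev x hx).fderiv_eq]
    have hd : HasFDerivAt w (fderiv ℝ w x) x :=
      (((hw x hx).contDiffAt (hU.mem_nhds hx)).differentiableAt (by norm_num)).hasFDerivAt
    exact ((aux_pw_hasDerivAt hq (w x - η)).comp_hasFDerivAt x (hd.sub_const η)).fderiv

lemma aux_energy {n : ℕ} {U : Set (EuclideanSpace ℝ (Fin n))}
    (hU : IsOpen U) (hUb : Bornology.IsBounded U)
    {c : EuclideanSpace ℝ (Fin n) → ℝ} (hc : ContinuousOn c U) {M : ℝ}
    (hc0 : ∀ x ∈ U, 0 ≤ c x) (hM : ∀ x ∈ U, c x ≤ M) {μ : ℝ}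
    (H : ∀ φ : EuclideanSpace ℝ (Fin n) → ℝ,
      ContDiff ℝ (⊤ : ℕ∞) φ → HasCompactSupport φ → tsupport φ ⊆ U →
      μ * ∫ x in U, (φ x) ^ 2 ≤
        (∫ x in U, ‖gradient φ x‖ ^ 2) - ∫ x in U, c x * (φ x) ^ 2)
    {w : EuclideanSpace ℝ (Fin n) → ℝ} (hw : ContDiffOn ℝ 2 w U)
    (hpde : ∀ x ∈ U, 0 < w x → -lapn n w x ≤ c x * w x)
    {η : ℝ} (hη : 0 < η) (hK : IsCompact {x ∈ U | η ≤ w x})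
    {κ : ℝ} (hκ : 0 < κ) :
    (μ - κ ^ 2 * M) * ∫ x in U, (max (w x - η) 0) ^ (2 + 2 * κ) ≤
      (1 + κ) ^ 2 * η * M * ∫ x in U, (max (w x - η) 0) ^ (1 + 2 * κ) := by
  obtain ⟨h1, h2, h3, h4⟩ := aux_cut hU hw hK (q := 1 + κ) (by linarith)
  obtain ⟨k1, k2, k3, k4⟩ := aux_cut hU hw hK (q := 1 + 2 * κ) (by linarith)
  set φ := U.indicator (fun x => (max (w x - η) 0) ^ (1 + κ)) with hφ
  set ψ := U.indicator (fun x => (max (w x - η) 0) ^ (1 + 2 * κ)) with hψ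
  set K := {x ∈ U | η ≤ w x} with hKdef
  have hKU : K ⊆ U := fun x hx => hx.1
  have hφU : ∀ x ∈ U, φ x = (max (w x - η) 0) ^ (1 + κ) := fun x hx => Set.indicator_of_mem hx _
  have hψU : ∀ x ∈ U, ψ x = (max (w x - η) 0) ^ (1 + 2 * κ) :=
    fun x hx => Set.indicator_of_mem hx _
  have hψ0 : ∀ x, x ∉ K → ψ x = 0 := fun x hx => image_eq_zero_of_notMem_tsupport
    (fun h => hx (k3 h))
  have hφ0 : ∀ x, x ∉ K → φ x = 0 := fun x hx => image_eq_zero_of_notMem_tsupport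
    (fun h => hx (h3 h))
  have hφ2 : ∀ x ∈ U, φ x ^ 2 = (max (w x - η) 0) ^ (2 + 2 * κ) := by
    intro x hx
    rw [hφU x hx, ← Real.rpow_natCast, ← Real.rpow_mul (le_max_right _ _)]
    congr 1; push_cast; ring
  have hdψ0 : ∀ x, x ∉ K → fderiv ℝ ψ x = 0 := fun x hx =>
    image_eq_zero_of_notMem_tsupport (fun h => hx (k3 (tsupport_fderiv_subset ℝ h)))
  have Hφ := aux_test_C1 hU hUb hc (M := M)
    (fun x hx => by rw [abs_of_nonneg (hc0 x hx)]; exact hM x hx) H h1 h2 (h3.trans hKU)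
  have hwd : ∀ i : Fin n, ContDiffOn ℝ 1
      (fun y => fderiv ℝ w y (EuclideanSpace.single i 1)) U := fun i =>
    (hw.fderiv_of_isOpen hU (by norm_num)).clm_apply contDiffOn_const
  have hwdd : ∀ i : Fin n, ContinuousOn
      (fun x => fderiv ℝ (fun y => fderiv ℝ w y (EuclideanSpace.single i 1)) x
        (EuclideanSpace.single i 1)) U := fun i =>
    ((hwd i).continuousOn_fderiv_of_isOpen hU le_rfl).clm_apply continuousOn_const
  -- integrability
  have iA : ∀ i : Fin n, Integrable (fun x => fderiv ℝ ψ x (EuclideanSpace.single i 1) *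
      fderiv ℝ w x (EuclideanSpace.single i 1)) := fun i =>
    aux_integrable_cpt hK hKU
      ((((k1.continuous_fderiv one_ne_zero).clm_apply continuous_const).continuousOn).mul
        (hwd i).continuousOn) (fun x hx => by simp [hdψ0 x hx])
  have iB : ∀ i : Fin n, Integrable (fun x => ψ x *
      fderiv ℝ (fun y => fderiv ℝ w y (EuclideanSpace.single i 1)) x
        (EuclideanSpace.single i 1)) := fun i =>
    aux_integrable_cpt hK hKU (k1.continuous.continuousOn.mul (hwdd i))
      (fun x hx => by simp [hψ0 x hx])
  have iC : ∀ i : Fin n, Integrable (fun x => ψ x *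
      fderiv ℝ w x (EuclideanSpace.single i 1)) := fun i =>
    aux_integrable_cpt hK hKU (k1.continuous.continuousOn.mul (hwd i).continuousOn)
      (fun x hx => by simp [hψ0 x hx])
  have iD : Integrable (fun x => c x * φ x ^ 2) :=
    aux_integrable_cpt hK hKU (hc.mul (h1.continuous.pow 2).continuousOn)
      (fun x hx => by simp [hφ0 x hx])
  have iE : Integrable (fun x => c x * ψ x) :=
    aux_integrable_cpt hK hKU (hc.mul k1.continuous.continuousOn)
      (fun x hx => by simp [hψ0 x hx])
  have iF : Integrable (fun x => φ x ^ 2) :=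
    aux_integrable_cpt hK hKU ((h1.continuous.pow 2).continuousOn)
      (fun x hx => by simp [hφ0 x hx])
  have iG : Integrable ψ :=
    aux_integrable_cpt hK hKU (k1.continuous.continuousOn)
      (fun x hx => by simp [hψ0 x hx])
  -- integration by parts
  have ibp : ∀ i : Fin n, ∫ x, ψ x *
      fderiv ℝ (fun y => fderiv ℝ w y (EuclideanSpace.single i 1)) x
        (EuclideanSpace.single i 1) = - ∫ x, fderiv ℝ ψ x (EuclideanSpace.single i 1) *
      fderiv ℝ w x (EuclideanSpace.single i 1) := fun i =>
    integral_mul_fderiv_eq_neg_fderiv_mul_of_integrable (iA i) (iB i) (iC i)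
      (fun x _ => k1.differentiable one_ne_zero x)
      (fun x hx => (((hwd i) x (hKU (k3 hx))).contDiffAt
        (hU.mem_nhds (hKU (k3 hx)))).differentiableAt one_ne_zero)
  have ibp' : ∫ x in U, ∑ i : Fin n, fderiv ℝ ψ x (EuclideanSpace.single i 1) *
      fderiv ℝ w x (EuclideanSpace.single i 1) = ∫ x in U, ψ x * (-lapn n w x) := by
    rw [setIntegral_eq_integral_of_forall_compl_eq_zero
        (fun x hx => by simp [hdψ0 x (fun h => hx (hKU h))]),
      setIntegral_eq_integral_of_forall_compl_eq_zero
        (fun x hx => by simp [hψ0 x (fun h => hx (hKU h))]),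
      integral_finsetSum _ (fun i _ => iA i)]
    simp_rw [mul_neg]
    rw [integral_neg]
    unfold lapn
    simp_rw [Finset.mul_sum]
    rw [integral_finsetSum _ (fun i _ => iB i), ← Finset.sum_neg_distrib]
    exact Finset.sum_congr rfl fun i _ => by rw [ibp i, neg_neg]
  set θ : ℝ := (1 + κ) ^ 2 / (1 + 2 * κ) with hθ
  have hθ0 : 0 < θ := by positivity
  have hθ1 : θ - 1 ≤ κ ^ 2 := by
    rw [hθ, sub_le_iff_le_add, div_le_iff₀ (by positivity)]
    nlinarith [pow_pos hκ 3]
  have hθ1' : 0 ≤ θ - 1 := by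
    rw [hθ, sub_nonneg, le_div_iff₀ (by positivity)]
    nlinarith
  have hθ2 : θ ≤ (1 + κ) ^ 2 := by
    rw [hθ]; apply div_le_self (by positivity); linarith
  have grad : ∫ x in U, ‖gradient φ x‖ ^ 2 =
      θ * ∫ x in U, ∑ i : Fin n, fderiv ℝ ψ x (EuclideanSpace.single i 1) *
      fderiv ℝ w x (EuclideanSpace.single i 1) := by
    rw [← integral_const_mul]
    refine setIntegral_congr_fun hU.measurableSet fun x hx => ?_
    simp only [aux_norm_sq_gradient, Finset.mul_sum, h4 x hx, k4 x hx,
      _root_.smul_apply, smul_eq_mul]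
    refine Finset.sum_congr rfl fun i _ => ?_
    have e1 : (max (w x - η) 0) ^ (1 + 2 * κ - 1) = ((max (w x - η) 0) ^ (1 + κ - 1)) ^ 2 := by
      rw [← Real.rpow_natCast, ← Real.rpow_mul (le_max_right _ _)]
      congr 1; push_cast; ring
    rw [e1, hθ]
    field_simp
  have mono : ∫ x in U, ψ x * (-lapn n w x) ≤ ∫ x in U, (c x * φ x ^ 2 + η * (c x * ψ x)) := by
    refine setIntegral_mono_on ?_ (iD.add (iE.const_mul η)).integrableOn hU.measurableSet ?_
    · refine Integrable.integrableOn ?_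
      unfold lapn
      simp_rw [mul_neg, Finset.mul_sum]
      exact (integrable_finsetSum _ fun i _ => iB i).neg
    · intro x hx
      rw [hφ2 x hx, hψU x hx]
      rcases le_or_gt (w x) η with h | h
      · rw [max_eq_right (by linarith), Real.zero_rpow (by linarith),
          Real.zero_rpow (by linarith)]
        simp
      · rw [max_eq_left (by linarith)]
        have hV : 0 < w x - η := by linarith
        have e2 : (w x - η) ^ (2 + 2 * κ) = (w x - η) ^ (1 + 2 * κ) * (w x - η) := by
          rw [← Real.rpow_add_one hV.ne']; congr 1; ring
        rw [e2]
        have := mul_le_mul_of_nonneg_left (hpde x hx (by linarith))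
          (Real.rpow_nonneg hV.le (1 + 2 * κ))
        linarith
  rw [integral_add iD.integrableOn (iE.const_mul η).integrableOn, integral_const_mul] at mono
  have e3 : ∫ x in U, (max (w x - η) 0) ^ (2 + 2 * κ) = ∫ x in U, φ x ^ 2 :=
    setIntegral_congr_fun hU.measurableSet fun x hx => (hφ2 x hx).symm
  have e4 : ∫ x in U, (max (w x - η) 0) ^ (1 + 2 * κ) = ∫ x in U, ψ x :=
    setIntegral_congr_fun hU.measurableSet fun x hx => (hψU x hx).symm
  rw [e3, e4]
  have cD : ∫ x in U, c x * φ x ^ 2 ≤ M * ∫ x in U, φ x ^ 2 := by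
    rw [← integral_const_mul]
    refine setIntegral_mono_on iD.integrableOn (iF.const_mul M).integrableOn hU.measurableSet ?_
    intro x hx
    exact mul_le_mul_of_nonneg_right (hM x hx) (sq_nonneg _)
  have hψn : ∀ x ∈ U, 0 ≤ ψ x := fun x hx => by
    rw [hψU x hx]; exact Real.rpow_nonneg (le_max_right _ _) _
  have cE : ∫ x in U, c x * ψ x ≤ M * ∫ x in U, ψ x := by
    rw [← integral_const_mul]
    refine setIntegral_mono_on iE.integrableOn (iG.const_mul M).integrableOn hU.measurableSet ?_
    intro x hx
    exact mul_le_mul_of_nonneg_right (hM x hx) (hψn x hx)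
  have pD : 0 ≤ ∫ x in U, c x * φ x ^ 2 :=
    setIntegral_nonneg hU.measurableSet fun x hx => mul_nonneg (hc0 x hx) (sq_nonneg _)
  have pE : 0 ≤ ∫ x in U, c x * ψ x :=
    setIntegral_nonneg hU.measurableSet fun x hx => mul_nonneg (hc0 x hx) (hψn x hx)
  rw [grad, ibp'] at Hφ
  have s1 := mul_le_mul_of_nonneg_left mono hθ0.le
  have s2 : (θ - 1) * ∫ x in U, c x * φ x ^ 2 ≤ κ ^ 2 * (M * ∫ x in U, φ x ^ 2) :=
    mul_le_mul hθ1 cD pD (by positivity)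
  have s3 : θ * (∫ x in U, c x * ψ x) ≤ (1 + κ) ^ 2 * (M * ∫ x in U, ψ x) :=
    mul_le_mul hθ2 cE pE (by positivity)
  have s4 := mul_le_mul_of_nonneg_left s3 hη.le
  linarith

lemma aux_nonpos {n : ℕ} {U : Set (EuclideanSpace ℝ (Fin n))}
    (hU : IsOpen U) (hUb : Bornology.IsBounded U)
    {c : EuclideanSpace ℝ (Fin n) → ℝ} (hc : ContinuousOn c U) {M : ℝ}
    (hc0 : ∀ x ∈ U, 0 ≤ c x) (hM : ∀ x ∈ U, c x ≤ M) {μ : ℝ} (hμ : 0 < μ)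
    (H : ∀ φ : EuclideanSpace ℝ (Fin n) → ℝ,
      ContDiff ℝ (⊤ : ℕ∞) φ → HasCompactSupport φ → tsupport φ ⊆ U →
      μ * ∫ x in U, (φ x) ^ 2 ≤
        (∫ x in U, ‖gradient φ x‖ ^ 2) - ∫ x in U, c x * (φ x) ^ 2)
    {w : EuclideanSpace ℝ (Fin n) → ℝ} (hw : ContDiffOn ℝ 2 w U)
    (hpde : ∀ x ∈ U, 0 < w x → -lapn n w x ≤ c x * w x)
    (hK : ∀ η > 0, IsCompact {x ∈ U | η ≤ w x}) :
    ∀ x ∈ U, w x ≤ 0 := by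
  intro y hy
  by_contra! hwy
  have hM0 : 0 ≤ M := (hc0 y hy).trans (hM y hy)
  -- choice of κ
  set κ : ℝ := Real.sqrt (μ / (2 * (M + 1))) with hκd
  have hκ : 0 < κ := Real.sqrt_pos.2 (by positivity)
  have hκ2 : κ ^ 2 * M ≤ μ / 2 := by
    rw [hκd, Real.sq_sqrt (by positivity), div_mul_eq_mul_div, div_le_div_iff₀ (by positivity) two_pos]
    nlinarith
  -- upper bound for w
  obtain ⟨A, hA1, hA⟩ : ∃ A, 1 ≤ A ∧ ∀ x ∈ U, w x ≤ A := by
    have hcont : ContinuousOn w {x ∈ U | 1 ≤ w x} :=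
      hw.continuousOn.mono (fun x hx => hx.1)
    obtain ⟨A, hA⟩ := (hK 1 one_pos).bddAbove_image hcont
    refine ⟨max A 1, le_max_right _ _, fun x hx => ?_⟩
    rcases le_or_gt 1 (w x) with h | h
    · exact (hA ⟨x, ⟨hx, h⟩, rfl⟩).trans (le_max_left _ _)
    · exact h.le.trans (le_max_right _ _)
  have hfin : IsFiniteMeasure (volume.restrict U) := ⟨by simpa using hUb.measure_lt_top⟩
  -- lower bound
  obtain ⟨r, hr, hball⟩ : ∃ r > 0, ∀ x ∈ Metric.ball y r, x ∈ U ∧ w y / 2 < w x := by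
    have e1 : ∀ᶠ x in 𝓝 y, x ∈ U ∧ w y / 2 < w x :=
      (hU.eventually_mem hy).and ((hw.continuousOn.continuousAt (hU.mem_nhds hy)).eventually
        (lt_mem_nhds (by linarith)))
    exact Metric.eventually_nhds_iff_ball.1 e1
  set L : ℝ := (w y / 4) ^ (2 + 2 * κ) * volume.real (Metric.ball y r) with hL
  have hvol : 0 < volume.real (Metric.ball y r) :=
    ENNReal.toReal_pos (Metric.measure_ball_pos volume y hr).ne' measure_ball_lt_top.ne
  have hL0 : 0 < L := mul_pos (Real.rpow_pos_of_pos (by linarith) _) hvol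
  set R : ℝ := (1 + κ) ^ 2 * M * (A ^ (1 + 2 * κ) * volume.real U) with hR
  have hR0 : 0 ≤ R := by
    have := Real.rpow_nonneg (by linarith : 0 ≤ A) (1 + 2 * κ)
    positivity
  have key : ∀ η, 0 < η → η ≤ w y / 4 → μ / 2 * L ≤ η * R := by
    intro η hη hη4
    have := aux_energy hU hUb hc hc0 hM H hw hpde hη (hK η hη) hκ
    have hcont : ∀ q : ℝ, 0 ≤ q → ContinuousOn (fun x => (max (w x - η) 0) ^ q) U := fun q hq =>
      (ContinuousOn.sup (f := fun x => w x - η) (g := fun _ => (0 : ℝ))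
        (hw.continuousOn.sub continuousOn_const) continuousOn_const).rpow_const
        (fun _ _ => Or.inr hq)
    have hint : ∀ q : ℝ, 0 ≤ q → IntegrableOn (fun x => (max (w x - η) 0) ^ q) U := fun q hq => by
      refine Integrable.mono' (integrable_const (A ^ q))
        ((hcont q hq).aestronglyMeasurable hU.measurableSet) ?_
      filter_upwards [ae_restrict_mem hU.measurableSet] with x hx
      rw [Real.norm_of_nonneg (Real.rpow_nonneg (le_max_right _ _) _)]
      refine Real.rpow_le_rpow (le_max_right _ _) ?_ hq
      have := hA x hx
      exact max_le (by linarith) (by linarith)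
    have up : ∫ x in U, (max (w x - η) 0) ^ (1 + 2 * κ) ≤ A ^ (1 + 2 * κ) * volume.real U := by
      have h5 : ∫ x in U, (max (w x - η) 0) ^ (1 + 2 * κ) ≤ ∫ x in U, A ^ (1 + 2 * κ) := by
        refine setIntegral_mono_on (hint _ (by linarith)) (integrable_const _) hU.measurableSet ?_
        intro x hx
        refine Real.rpow_le_rpow (le_max_right _ _) ?_ (by linarith)
        have := hA x hx
        exact max_le (by linarith) (by linarith)
      rw [setIntegral_const, smul_eq_mul, mul_comm (volume.real U)] at h5
      exact h5
    have lo : L ≤ ∫ x in U, (max (w x - η) 0) ^ (2 + 2 * κ) := by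
      have hsub : Metric.ball y r ⊆ U := fun x hx => (hball x hx).1
      have h6 : ∫ x in Metric.ball y r, (w y / 4) ^ (2 + 2 * κ) ≤
          ∫ x in Metric.ball y r, (max (w x - η) 0) ^ (2 + 2 * κ) := by
        refine setIntegral_mono_on ?_ ((hint _ (by linarith)).mono_set hsub)
          measurableSet_ball ?_
        · exact integrableOn_const (measure_ball_lt_top).ne
        · intro x hx
          refine Real.rpow_le_rpow (by linarith) ?_ (by linarith)
          have := (hball x hx).2
          exact le_max_of_le_left (by linarith)
      have h7 : ∫ x in Metric.ball y r, (max (w x - η) 0) ^ (2 + 2 * κ) ≤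
          ∫ x in U, (max (w x - η) 0) ^ (2 + 2 * κ) := by
        refine setIntegral_mono_set (hint _ (by linarith)) ?_ hsub.eventuallyLE
        exact Eventually.of_forall fun x => Real.rpow_nonneg (le_max_right _ _) _
      rw [setIntegral_const, smul_eq_mul, mul_comm (volume.real _)] at h6
      exact h6.trans h7
    have t1 : μ / 2 * L ≤ (μ - κ ^ 2 * M) * ∫ x in U, (max (w x - η) 0) ^ (2 + 2 * κ) :=
      mul_le_mul (by linarith) lo hL0.le (by linarith)
    have t2 : (1 + κ) ^ 2 * η * M * ∫ x in U, (max (w x - η) 0) ^ (1 + 2 * κ) ≤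
        (1 + κ) ^ 2 * η * M * (A ^ (1 + 2 * κ) * volume.real U) :=
      mul_le_mul_of_nonneg_left up (by positivity)
    calc μ / 2 * L ≤ _ := t1
      _ ≤ _ := this
      _ ≤ _ := t2
      _ = η * R := by rw [hR]; ring
  set η0 : ℝ := min (w y / 4) (μ / 4 * L / (R + 1)) with hη0
  have hp : 0 < η0 := lt_min (by linarith) (by positivity)
  have := key η0 hp (min_le_left _ _)
  have h8 : η0 * (R + 1) ≤ μ / 4 * L := by
    rw [← le_div_iff₀ (by positivity)]; exact min_le_right _ _
  nlinarith [mul_pos hμ hL0]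
lemma aux_fderiv_apply_self {n : ℕ} {Ω : Set (EuclideanSpace ℝ (Fin n))} (hΩ : IsOpen Ω)
    {u : EuclideanSpace ℝ (Fin n) → ℝ} (hu : ContDiffOn ℝ 3 u Ω)
    (x₀ : EuclideanSpace ℝ (Fin n)) (a : ℝ) {x : EuclideanSpace ℝ (Fin n)} (hx : x ∈ Ω) :
    lapn n (fun y => fderiv ℝ u y (y - x₀) + a * u y) x =
      fderiv ℝ (lapn n u) x (x - x₀) + (2 + a) * lapn n u x := by
  have hF2 : ContDiffOn ℝ 2 (fderiv ℝ u) Ω := hu.fderiv_of_isOpen hΩ (by norm_num)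
  have hF1 : ContDiffOn ℝ 1 (fderiv ℝ (fderiv ℝ u)) Ω := hF2.fderiv_of_isOpen hΩ (by norm_num)
  have hud : ∀ y ∈ Ω, HasFDerivAt u (fderiv ℝ u y) y := fun y hy =>
    (((hu y hy).contDiffAt (hΩ.mem_nhds hy)).differentiableAt (by norm_num)).hasFDerivAt
  have hFd : ∀ y ∈ Ω, HasFDerivAt (fderiv ℝ u) (fderiv ℝ (fderiv ℝ u) y) y := fun y hy =>
    (((hF2 y hy).contDiffAt (hΩ.mem_nhds hy)).differentiableAt (by norm_num)).hasFDerivAt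
  have hGd : ∀ y ∈ Ω, HasFDerivAt (fderiv ℝ (fderiv ℝ u))
      (fderiv ℝ (fderiv ℝ (fderiv ℝ u)) y) y := fun y hy =>
    (((hF1 y hy).contDiffAt (hΩ.mem_nhds hy)).differentiableAt (by norm_num)).hasFDerivAt
  set F := fderiv ℝ u with hF
  set G := fderiv ℝ F with hG
  set T := fderiv ℝ G x with hT
  have hnh : ∀ᶠ y in 𝓝 x, y ∈ Ω := hΩ.eventually_mem hx
  have symG : ∀ y ∈ Ω, ∀ v z, G y v z = G y z v := fun y hy v z =>
    (((hu y hy).contDiffAt (hΩ.mem_nhds hy)).isSymmSndFDerivAt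
      (by simp only [minSmoothness_of_isRCLikeNormedField]; norm_num)) v z
  have symT1 : ∀ v z : EuclideanSpace ℝ (Fin n), T v z = T z v := fun v z =>
    (((hF2 x hx).contDiffAt (hΩ.mem_nhds hx)).isSymmSndFDerivAt
      (by simp only [minSmoothness_of_isRCLikeNormedField]; norm_num)) v z
  have dGvz : ∀ v z : EuclideanSpace ℝ (Fin n), HasFDerivAt (fun y => G y v z)
      ((ContinuousLinearMap.apply ℝ ℝ z).comp
        (T.flip v)) x := by
    intro v z
    have h1 : HasFDerivAt (fun y => G y v) (T.flip v) x := by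
      simpa using (hGd x hx).clm_apply (hasFDerivAt_const v x)
    exact (ContinuousLinearMap.hasFDerivAt (ContinuousLinearMap.apply ℝ ℝ z)).comp x h1
  have symT2 : ∀ c v z : EuclideanSpace ℝ (Fin n), T c v z = T c z v := by
    intro c v z
    have e : (fun y => G y v z) =ᶠ[𝓝 x] (fun y => G y z v) := by
      filter_upwards [hnh] with y hy using symG y hy v z
    have := e.fderiv_eq (𝕜 := ℝ)
    rw [(dGvz v z).fderiv, (dGvz z v).fderiv] at this
    simpa using DFunLike.congr_fun this c
  have dF : ∀ y ∈ Ω, ∀ v, fderiv ℝ (fun y => F y v) y = (ContinuousLinearMap.apply ℝ ℝ v).comp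
      (G y) := fun y hy v =>
    ((ContinuousLinearMap.hasFDerivAt (ContinuousLinearMap.apply ℝ ℝ v)).comp y (hFd y hy)).fderiv
  have lapu : ∀ y ∈ Ω, lapn n u y =
      ∑ i : Fin n, G y (EuclideanSpace.single i 1) (EuclideanSpace.single i 1) := by
    intro y hy
    unfold lapn
    refine Finset.sum_congr rfl fun i _ => ?_
    rw [dF y hy]; rfl
  have dlap : fderiv ℝ (lapn n u) x (x - x₀) =
      ∑ i : Fin n, T (x - x₀) (EuclideanSpace.single i 1) (EuclideanSpace.single i 1) := by
    have e : lapn n u =ᶠ[𝓝 x] (fun y => ∑ i : Fin n,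
        G y (EuclideanSpace.single i 1) (EuclideanSpace.single i 1)) := by
      filter_upwards [hnh] with y hy using lapu y hy
    rw [e.fderiv_eq, (HasFDerivAt.fun_sum (fun i _ => dGvz _ _)).fderiv]
    simp
  have dw : ∀ y ∈ Ω, ∀ v, fderiv ℝ (fun y => F y (y - x₀) + a * u y) y v =
      G y v (y - x₀) + (1 + a) * F y v := by
    intro y hy v
    have h1 := ((hFd y hy).clm_apply ((hasFDerivAt_id y).sub_const x₀)).add
      ((hud y hy).const_mul a)
    have h2 := h1.fderiv
    have h3 : fderiv ℝ (fun y => F y (y - x₀) + a * u y) y = _ := h2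
    rw [h3]
    simp
    ring
  rw [dlap, lapu x hx]
  unfold lapn
  rw [Finset.mul_sum, ← Finset.sum_add_distrib]
  refine Finset.sum_congr rfl fun i _ => ?_
  set e : EuclideanSpace ℝ (Fin n) := EuclideanSpace.single i 1
  have ev : (fun y => fderiv ℝ (fun y => F y (y - x₀) + a * u y) y e) =ᶠ[𝓝 x]
      (fun y => G y e (y - x₀) + (1 + a) * F y e) := by
    filter_upwards [hnh] with y hy using dw y hy e
  rw [ev.fderiv_eq]
  have h1 : HasFDerivAt (fun y => G y e) (T.flip e) x := by
    simpa using (hGd x hx).clm_apply (hasFDerivAt_const e x)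
  have h2 : HasFDerivAt (fun y => F y e) ((ContinuousLinearMap.apply ℝ ℝ e).comp (G x)) x :=
    (ContinuousLinearMap.hasFDerivAt (ContinuousLinearMap.apply ℝ ℝ e)).comp x (hFd x hx)
  have h3 := ((h1.clm_apply ((hasFDerivAt_id x).sub_const x₀)).add (h2.const_mul (1 + a))).fderiv
  have h4 : fderiv ℝ (fun y => G y e (y - x₀) + (1 + a) * F y e) x = _ := h3
  rw [h4]
  have : T e e (x - x₀) = T (x - x₀) e e := by rw [symT2 e e, symT1 e (x - x₀)]
  simp at this ⊢
  linear_combination this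

lemma aux_lapn_w {n : ℕ} {Ω : Set (EuclideanSpace ℝ (Fin n))} (hΩ : IsOpen Ω)
    {u : EuclideanSpace ℝ (Fin n) → ℝ} (hu : ContDiffOn ℝ 3 u Ω) {p lam : ℝ} (hp : 1 < p)
    (hupos : ∀ x ∈ Ω, 0 < u x)
    (hueq : ∀ x ∈ Ω, -lapn n u x + lam * u x = u x ^ p)
    (x₀ : EuclideanSpace ℝ (Fin n)) {x : EuclideanSpace ℝ (Fin n)} (hx : x ∈ Ω) :
    lapn n (fun y => fderiv ℝ u y (y - x₀) + 2 / (p - 1) * u y) x =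
      (lam - p * u x ^ (p - 1)) * (fderiv ℝ u x (x - x₀) + 2 / (p - 1) * u x)
        + 2 * lam * u x := by
  rw [aux_fderiv_apply_self hΩ hu x₀ _ hx]
  have e : lapn n u =ᶠ[𝓝 x] (fun y => lam * u y - u y ^ p) := by
    filter_upwards [hΩ.eventually_mem hx] with y hy
    linarith [hueq y hy]
  have hud : HasFDerivAt u (fderiv ℝ u x) x :=
    (((hu x hx).contDiffAt (hΩ.mem_nhds hx)).differentiableAt (by norm_num)).hasFDerivAt
  have h2 : HasFDerivAt (fun y => lam * u y - u y ^ p) _ x := (hud.const_mul lam).sub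
    ((Real.hasDerivAt_rpow_const (p := p) (Or.inl (hupos x hx).ne')).comp_hasFDerivAt x hud)
  rw [e.fderiv_eq, h2.fderiv, e.eq_of_nhds]
  have h3 : u x ^ p = u x ^ (p - 1) * u x := by
    rw [← Real.rpow_add_one (hupos x hx).ne']; congr 1; ring
  have : p - 1 ≠ 0 := by linarith
  simp [h3]
  field_simp
  ring

lemma aux_lapn_max {n : ℕ} {g : EuclideanSpace ℝ (Fin n) → ℝ} {x : EuclideanSpace ℝ (Fin n)}
    (hg : ContDiffAt ℝ 2 g x) (hmax : IsLocalMax g x) : lapn n g x ≤ 0 := by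
  unfold lapn
  refine Finset.sum_nonpos fun i _ => ?_
  set e : EuclideanSpace ℝ (Fin n) := EuclideanSpace.single i 1
  by_contra! hpos
  have hline : ∀ s : ℝ, HasDerivAt (fun s : ℝ => x + s • e) e s := fun s => by
    simpa using ((hasDerivAt_id s).smul_const e).const_add x
  have hcont : Tendsto (fun s : ℝ => x + s • e) (𝓝 0) (𝓝 x) := by
    have := (hline 0).continuousAt.tendsto
    simpa using this
  let h : ℝ → ℝ := fun s => g (x + s • e)
  have hd : ∀ᶠ s in 𝓝 (0 : ℝ), HasDerivAt h (fderiv ℝ g (x + s • e) e) s := by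
    have h1 : ∀ᶠ y in 𝓝 x, DifferentiableAt ℝ g y := by
      filter_upwards [hg.eventually (by simp)] with y hy
      exact hy.differentiableAt (by norm_num)
    filter_upwards [hcont.eventually h1] with s hs
    exact hs.hasFDerivAt.comp_hasDerivAt s (hline s)
  have hd' : deriv h =ᶠ[𝓝 0] fun s => fderiv ℝ g (x + s • e) e := by
    filter_upwards [hd] with s hs using hs.deriv
  have hdd : deriv (deriv h) 0 = fderiv ℝ (fun y => fderiv ℝ g y e) x e := by
    rw [hd'.deriv_eq]
    have h2 : DifferentiableAt ℝ (fun y => fderiv ℝ g y e) x :=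
      ((hg.fderiv_right (m := 1) (by norm_num)).differentiableAt one_ne_zero).clm_apply
        (differentiableAt_const _)
    have h3 : HasFDerivAt (fun y => fderiv ℝ g y e) (fderiv ℝ (fun y => fderiv ℝ g y e) x)
        (x + (0 : ℝ) • e) := by simpa using h2.hasFDerivAt
    exact (h3.comp_hasDerivAt (0 : ℝ) (hline 0)).deriv
  have hm : IsLocalMax h 0 := by
    have := hcont.eventually hmax
    filter_upwards [this] with s hs
    simpa [h] using hs
  have hmin : IsLocalMin h 0 := isLocalMin_of_deriv_deriv_pos (by rw [hdd]; exact hpos)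
    hm.deriv_eq_zero hd.self_of_nhds.continuousAt
  have hconst : h =ᶠ[𝓝 0] fun _ => h 0 := by
    filter_upwards [hm, hmin] with s h1 h2 using le_antisymm h1 h2
  have : deriv (deriv h) 0 = 0 := by
    rw [(hconst.deriv).deriv_eq]
    simp
  rw [hdd] at this
  linarith

lemma aux_lapn_sub {n : ℕ} {f g : EuclideanSpace ℝ (Fin n) → ℝ} {x : EuclideanSpace ℝ (Fin n)}
    (hf : ContDiffAt ℝ 2 f x) (hg : ContDiffAt ℝ 2 g x) :
    lapn n (fun y => f y - g y) x = lapn n f x - lapn n g x := by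
  unfold lapn
  rw [← Finset.sum_sub_distrib]
  refine Finset.sum_congr rfl fun i _ => ?_
  set e : EuclideanSpace ℝ (Fin n) := EuclideanSpace.single i 1
  have dd : ∀ {f : EuclideanSpace ℝ (Fin n) → ℝ}, ContDiffAt ℝ 2 f x →
      DifferentiableAt ℝ (fun y => fderiv ℝ f y e) x := fun hf =>
    ((hf.fderiv_right (m := 1) (by norm_num)).differentiableAt one_ne_zero).clm_apply
        (differentiableAt_const _)
  have ev : (fun y => fderiv ℝ (fun y => f y - g y) y e) =ᶠ[𝓝 x]
      fun y => fderiv ℝ f y e - fderiv ℝ g y e := by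
    filter_upwards [hf.eventually (by simp), hg.eventually (by simp)] with y h1 h2
    rw [fderiv_fun_sub (h1.differentiableAt (by norm_num)) (h2.differentiableAt (by norm_num))]
    rfl
  rw [ev.fderiv_eq, fderiv_fun_sub (dd hf) (dd hg)]
  rfl

lemma aux_lapn_dil {n : ℕ} {u : EuclideanSpace ℝ (Fin n) → ℝ} (x₀ : EuclideanSpace ℝ (Fin n))
    (t T : ℝ) {x : EuclideanSpace ℝ (Fin n)}
    (hu : ContDiffAt ℝ 2 u (x₀ + t • (x - x₀))) :
    lapn n (fun y => T * u (x₀ + t • (y - x₀))) x = T * t ^ 2 * lapn n u (x₀ + t • (x - x₀)) := by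
  unfold lapn
  rw [Finset.mul_sum]
  refine Finset.sum_congr rfl fun i _ => ?_
  set e : EuclideanSpace ℝ (Fin n) := EuclideanSpace.single i 1
  have hA : ∀ y, HasFDerivAt (fun y => x₀ + t • (y - x₀))
      (t • ContinuousLinearMap.id ℝ (EuclideanSpace ℝ (Fin n))) y := fun y =>
    (((hasFDerivAt_id y).sub_const x₀).const_smul t).const_add x₀
  have ev : (fun y => fderiv ℝ (fun y => T * u (x₀ + t • (y - x₀))) y e) =ᶠ[𝓝 x]
      fun y => T * t * fderiv ℝ u (x₀ + t • (y - x₀)) e := by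
    filter_upwards [(hA x).continuousAt.eventually (hu.eventually (by simp))] with y hy
    have h1 : HasFDerivAt (fun y => T * u (x₀ + t • (y - x₀))) _ y :=
      (((hy.differentiableAt (by norm_num)).hasFDerivAt.comp y (hA y)).const_mul T)
    rw [h1.fderiv]
    simp
    ring
  rw [ev.fderiv_eq]
  have h2 : DifferentiableAt ℝ (fun y => fderiv ℝ u y e) (x₀ + t • (x - x₀)) :=
    ((hu.fderiv_right (m := 1) (by norm_num)).differentiableAt one_ne_zero).clm_apply
        (differentiableAt_const _)
  have h3 : HasFDerivAt (fun y => T * t * fderiv ℝ u (x₀ + t • (y - x₀)) e) _ x :=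
    (h2.hasFDerivAt.comp x (hA x)).const_mul (T * t)
  rw [h3.fderiv]
  simp
  ring

lemma aux_lapn_barrier {n : ℕ} (f : EuclideanSpace ℝ (Fin n) →L[ℝ] ℝ) (k D m : ℝ)
    (x : EuclideanSpace ℝ (Fin n)) :
    lapn n (fun y => m * ((k - f y) * (2 * D - (k - f y)))) x =
      -2 * m * ∑ i : Fin n, f (EuclideanSpace.single i 1) ^ 2 := by
  unfold lapn
  rw [Finset.mul_sum]
  refine Finset.sum_congr rfl fun i _ => ?_
  set e : EuclideanSpace ℝ (Fin n) := EuclideanSpace.single i 1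
  have hl : ∀ y, HasFDerivAt (fun y => k - f y) (-f) y := fun y => by
    simpa using (f.hasFDerivAt (x := y)).const_sub k
  have e1 : (fun y => fderiv ℝ (fun y => m * ((k - f y) * (2 * D - (k - f y)))) y e) =
      fun y => (2 * m * f e) * (k - f y) - 2 * m * D * f e := by
    funext y
    have h1 : HasFDerivAt (fun y => m * ((k - f y) * (2 * D - (k - f y)))) _ y :=
      (((hl y).mul ((hl y).const_sub (2 * D))).const_mul m)
    rw [h1.fderiv]
    simp
    ring
  rw [e1]
  have h2 : HasFDerivAt (fun y => (2 * m * f e) * (k - f y) - 2 * m * D * f e) _ x :=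
    ((hl x).const_mul (2 * m * f e)).sub_const _
  rw [h2.fderiv]
  simp
  ring
lemma aux_conv_ineq {p s r : ℝ} (hp : 1 < p) (hr : 0 < r) (hrs : r < s) :
    s ^ p - r ^ p ≤ p * s ^ (p - 1) * (s - r) := by
  have hs : 0 < s := hr.trans hrs
  have h1 := one_add_mul_self_le_rpow_one_add (s := r / s - 1)
    (by have := div_pos hr hs; linarith) hp.le
  rw [add_sub_cancel, Real.div_rpow hr.le hs.le] at h1
  have h2 : s ^ p = s ^ (p - 1) * s := by
    rw [← Real.rpow_add_one hs.ne']; congr 1; ring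
  have h3 : 0 < s ^ p := Real.rpow_pos_of_pos hs _
  have h4 := mul_le_mul_of_nonneg_right h1 h3.le
  rw [div_mul_cancel₀ _ h3.ne'] at h4
  have h5 : (1 + p * (r / s - 1)) * s ^ p = s ^ p - p * s ^ (p - 1) * (s - r) := by
    rw [h2]; field_simp; ring
  linarith

lemma aux_dil_deriv {n : ℕ} {u : EuclideanSpace ℝ (Fin n) → ℝ}
    (x₀ x : EuclideanSpace ℝ (Fin n)) (a : ℝ) {s : ℝ} (hs : 0 < s)
    (hu : DifferentiableAt ℝ u (x₀ + s • (x - x₀))) :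
    HasDerivAt (fun s : ℝ => s ^ a * u (x₀ + s • (x - x₀)))
      (s ^ (a - 1) * (fderiv ℝ u (x₀ + s • (x - x₀)) ((x₀ + s • (x - x₀)) - x₀) +
        a * u (x₀ + s • (x - x₀)))) s := by
  have hline : HasDerivAt (fun s : ℝ => x₀ + s • (x - x₀)) (x - x₀) s := by
    simpa using ((hasDerivAt_id s).smul_const (x - x₀)).const_add x₀
  have h1 := (Real.hasDerivAt_rpow_const (x := s) (p := a) (Or.inl hs.ne')).mul
    (hu.hasFDerivAt.comp_hasDerivAt s hline)
  have h2 : s ^ a = s ^ (a - 1) * s := by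
    rw [← Real.rpow_add_one hs.ne']; congr 1; ring
  convert! h1 using 1
  simp [h2]
  ring

set_option maxHeartbeats 2000000 in
/-- Barrier at a boundary point. -/
lemma aux_barrier {n : ℕ} {Ω : Set (EuclideanSpace ℝ (Fin n))}
    (hΩ : IsOpen Ω) (hbd : Bornology.IsBounded Ω) (hconv : Convex ℝ Ω)
    {p lam : ℝ} (hp : 1 < p) (hlam : 0 ≤ lam)
    {u : EuclideanSpace ℝ (Fin n) → ℝ}
    (hu3 : ContDiffOn ℝ 3 u Ω) (hu1 : ContinuousOn u (closure Ω))
    (hupos : ∀ x ∈ Ω, 0 < u x)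
    (hueq : ∀ x ∈ Ω, -lapn n u x + lam * u x = u x ^ p)
    (hub : ∀ x ∈ frontier Ω, u x = 0)
    {x₀ : EuclideanSpace ℝ (Fin n)} (hx₀ : x₀ ∈ Ω)
    {z : EuclideanSpace ℝ (Fin n)} (hz : z ∈ frontier Ω) :
    ∃ b : EuclideanSpace ℝ (Fin n) → ℝ, Continuous b ∧ b z = 0 ∧
      ∀ x ∈ Ω, fderiv ℝ u x (x - x₀) + 2 / (p - 1) * u x ≤ b x := by
  set a : ℝ := 2 / (p - 1) with ha
  have hp1 : 0 < p - 1 := by linarith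
  have ha0 : 0 < a := by positivity
  have hap : a * p = a + 2 := by rw [ha]; field_simp; ring
  have hcl : IsCompact (closure Ω) := hbd.isCompact_closure
  have hzΩ : z ∉ Ω := by
    rw [hΩ.frontier_eq] at hz; exact hz.2
  have hfr : ∀ x ∈ closure Ω, x ∉ Ω → u x = 0 := fun x h1 h2 =>
    hub x (by rw [hΩ.frontier_eq]; exact ⟨h1, h2⟩)
  have hu2 : ∀ x ∈ Ω, ContDiffAt ℝ 2 u x := fun x hx =>
    ((hu3 x hx).contDiffAt (hΩ.mem_nhds hx)).of_le (by norm_num)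
  have hudiff : ∀ x ∈ Ω, DifferentiableAt ℝ u x := fun x hx =>
    (hu2 x hx).differentiableAt (by norm_num)
  obtain ⟨f, hf⟩ := geometric_hahn_banach_open_point hconv hΩ hzΩ
  obtain ⟨D, hD0, hD⟩ : ∃ D > 0, ∀ x ∈ Ω, f z - f x ≤ D := by
    obtain ⟨D, hD⟩ := hcl.bddAbove_image (f := fun x => f z - f x)
      ((continuous_const.sub f.continuous).continuousOn)
    refine ⟨max D 1, by positivity, fun x hx => ?_⟩
    exact (hD ⟨x, subset_closure hx, rfl⟩).trans (le_max_left _ _)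
  set B : EuclideanSpace ℝ (Fin n) → ℝ := fun x => (f z - f x) * (2 * D - (f z - f x)) with hB
  have hBc : Continuous B := by
    have := f.continuous
    fun_prop
  have hBpos : ∀ x ∈ Ω, 0 < B x := fun x hx => by
    have h1 := hf x hx
    have h2 := hD x hx
    exact mul_pos (by linarith) (by linarith)
  have hBle : ∀ x ∈ Ω, B x ≤ D ^ 2 := fun x hx => by
    simp only [hB]
    nlinarith [sq_nonneg (D - (f z - f x))]
  set κ : ℝ := ∑ i : Fin n, f (EuclideanSpace.single i 1) ^ 2 with hκd
  have hκ : 0 < κ := by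
    refine lt_of_le_of_ne (Finset.sum_nonneg fun i _ => sq_nonneg _) fun h => ?_
    have h0 : ∀ i : Fin n, f (EuclideanSpace.single i 1) = 0 := by
      intro i
      have := (Finset.sum_eq_zero_iff_of_nonneg (fun i _ => sq_nonneg
        (f (EuclideanSpace.single i (1 : ℝ))))).1 h.symm i (Finset.mem_univ i)
      exact pow_eq_zero_iff two_ne_zero |>.1 this
    have hf0 : ∀ x, f x = 0 := by
      intro x
      have : (f : EuclideanSpace ℝ (Fin n) →ₗ[ℝ] ℝ) = 0 := by
        refine (EuclideanSpace.basisFun (Fin n) ℝ).toBasis.ext fun i => ?_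
        simpa using h0 i
      exact DFunLike.congr_fun this x
    have := hf x₀ hx₀
    rw [hf0, hf0] at this
    exact lt_irrefl _ this
  obtain ⟨ε, hε, hεκ⟩ : ∃ ε > 0, p * ((2 : ℝ) ^ a * ε) ^ (p - 1) * D ^ 2 < 2 * κ := by
    have hc : ContinuousAt (fun ε : ℝ => p * ((2 : ℝ) ^ a * ε) ^ (p - 1) * D ^ 2) 0 := by
      refine (continuousAt_const.mul ?_).mul continuousAt_const
      exact (continuousAt_const.mul continuousAt_id).rpow_const (Or.inr hp1.le)
    have h0 : p * ((2 : ℝ) ^ a * 0) ^ (p - 1) * D ^ 2 < 2 * κ := by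
      rw [mul_zero, Real.zero_rpow hp1.ne']; simpa using hκ
    have h1 : ∀ᶠ ε in 𝓝[>] (0 : ℝ), p * ((2 : ℝ) ^ a * ε) ^ (p - 1) * D ^ 2 < 2 * κ :=
      nhdsWithin_le_nhds (hc.eventually (gt_mem_nhds h0))
    obtain ⟨ε, h2, h3⟩ := (h1.and self_mem_nhdsWithin).exists
    exact ⟨ε, h3, h2⟩
  set K : Set (EuclideanSpace ℝ (Fin n)) := closure Ω ∩ u ⁻¹' Set.Ici ε with hKd
  have hKc : IsCompact K := hcl.of_isClosed_subset
    (hu1.preimage_isClosed_of_isClosed isClosed_closure isClosed_Ici) Set.inter_subset_left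
  have hKΩ : K ⊆ Ω := by
    intro x hx
    by_contra h
    have h1 := hfr x hx.1 h
    have h2 : ε ≤ u x := hx.2
    linarith
  set K' : Set (EuclideanSpace ℝ (Fin n)) :=
    (fun q : ℝ × EuclideanSpace ℝ (Fin n) => x₀ + q.1 • (q.2 - x₀)) '' (Set.Icc (1 / 2) 1 ×ˢ K)
    with hK'd
  have hK'c : IsCompact K' := (isCompact_Icc.prod hKc).image (by fun_prop)
  have hK'Ω : K' ⊆ Ω := by
    rintro _ ⟨⟨s, y⟩, ⟨hs, hy⟩, rfl⟩
    exact hconv.add_smul_sub_mem hx₀ (hKΩ hy) ⟨by linarith [hs.1], hs.2⟩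
  set w : EuclideanSpace ℝ (Fin n) → ℝ := fun x => fderiv ℝ u x (x - x₀) + a * u x with hw
  have hwc : ContinuousOn w Ω :=
    ((hu3.continuousOn_fderiv_of_isOpen hΩ (by norm_num)).clm_apply
      (continuousOn_id.sub continuousOn_const)).add (continuousOn_const.mul hu3.continuousOn)
  obtain ⟨A, hA0, hA⟩ : ∃ A, 0 ≤ A ∧ ∀ x ∈ K', w x ≤ A := by
    obtain ⟨A, hA⟩ := hK'c.bddAbove_image (hwc.mono hK'Ω)
    exact ⟨max A 0, le_max_right _ _, fun x hx => (hA ⟨x, hx, rfl⟩).trans (le_max_left _ _)⟩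
  obtain ⟨β, hβ, hβB⟩ := hK'c.exists_forall_le' hBc.continuousOn (a := 0)
    (fun x hx => hBpos x (hK'Ω hx))
  set C : ℝ := 2 ^ a * A / β with hC
  have hC0 : 0 ≤ C := by positivity
  have key : ∀ t : ℝ, 1 < t → t < 2 → ∀ x, x₀ + t • (x - x₀) ∈ closure Ω →
      t ^ a * u (x₀ + t • (x - x₀)) - u x ≤ C * (t - 1) * B x := by
    intro t ht1 ht2
    have ht0 : 0 < t := by linarith
    have hTpos : 0 < t ^ a := Real.rpow_pos_of_pos ht0 _
    set d : EuclideanSpace ℝ (Fin n) → ℝ := fun x => t ^ a * u (x₀ + t • (x - x₀)) - u x with hd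
    set S : Set (EuclideanSpace ℝ (Fin n)) := (fun x => x₀ + t • (x - x₀)) ⁻¹' closure Ω with hS
    have hSimg : S = (fun y => x₀ + t⁻¹ • (y - x₀)) '' closure Ω := by
      ext x
      constructor
      · intro hx
        refine ⟨_, hx, ?_⟩
        simp [smul_smul, inv_mul_cancel₀ ht0.ne']
      · rintro ⟨y, hy, rfl⟩
        simpa [hS, smul_smul, mul_inv_cancel₀ ht0.ne'] using hy
    have hSc : IsCompact S := by
      rw [hSimg]; exact hcl.image (by fun_prop)
    have hSΩ : S ⊆ Ω := by
      rw [hSimg]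
      rintro _ ⟨y, hy, rfl⟩
      have hlt : t⁻¹ < 1 := inv_lt_one_of_one_lt₀ ht1
      have := hconv.combo_interior_closure_mem_interior (by rwa [hΩ.interior_eq]) hy
        (a := 1 - t⁻¹) (b := t⁻¹) (x := x₀) (by linarith) (by positivity) (by ring)
      rw [hΩ.interior_eq] at this
      convert this using 1
      module
    have hdc : ContinuousOn d S := by
      refine ContinuousOn.sub (continuousOn_const.mul ?_) (hu3.continuousOn.mono hSΩ)
      exact hu1.comp (by fun_prop) (fun x hx => hx)
    -- estimate on the compact part
    have hcomp : ∀ x, x₀ + t • (x - x₀) ∈ K → d x ≤ C * (t - 1) * B x := by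
      intro x hx
      have hpt : ∀ s ∈ Set.Icc 1 t, x₀ + s • (x - x₀) ∈ K' := by
        intro s hs
        refine ⟨⟨s / t, x₀ + t • (x - x₀)⟩, ⟨⟨?_, ?_⟩, hx⟩, ?_⟩
        · rw [div_le_div_iff₀ two_pos ht0]; linarith [hs.1]
        · rw [div_le_one ht0]; exact hs.2
        · simp [smul_smul, div_mul_cancel₀ _ ht0.ne']
      have hder : ∀ s ∈ Set.Icc 1 t, HasDerivAt (fun s : ℝ => s ^ a * u (x₀ + s • (x - x₀)))
          (s ^ (a - 1) * w (x₀ + s • (x - x₀))) s := fun s hs =>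
        aux_dil_deriv x₀ x a (by linarith [hs.1]) (hudiff _ (hK'Ω (hpt s hs)))
      obtain ⟨s, hs, hs'⟩ := exists_hasDerivAt_eq_slope _ _ ht1
        (fun s hs => (hder s hs).continuousAt.continuousWithinAt)
        (fun s hs => hder s ⟨hs.1.le, hs.2.le⟩)
      have hs1 : s ^ (a - 1) ≤ 2 ^ a := by
        calc s ^ (a - 1) ≤ s ^ a := Real.rpow_le_rpow_of_exponent_le hs.1.le (by linarith)
          _ ≤ 2 ^ a := Real.rpow_le_rpow (by linarith [hs.1]) (by linarith [hs.2]) ha0.le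
      have hs2 : s ^ (a - 1) * w (x₀ + s • (x - x₀)) ≤ 2 ^ a * A := by
        have h3 := hA _ (hpt s ⟨hs.1.le, hs.2.le⟩)
        have h4 : 0 ≤ s ^ (a - 1) := Real.rpow_nonneg (by linarith [hs.1]) _
        calc _ ≤ s ^ (a - 1) * A := mul_le_mul_of_nonneg_left h3 h4
          _ ≤ 2 ^ a * A := mul_le_mul_of_nonneg_right hs1 hA0
      rw [hs', div_le_iff₀ (by linarith)] at hs2
      have h5 : d x ≤ 2 ^ a * A * (t - 1) := by simpa [hd] using hs2
      have h6 : β ≤ B x := by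
        have := hpt 1 ⟨le_rfl, ht1.le⟩
        simp only [one_smul, add_sub_cancel] at this
        exact hβB x this
      have h7 : 2 ^ a * A * (t - 1) = C * (t - 1) * β := by
        rw [hC]; field_simp
      rw [h7] at h5
      exact h5.trans (mul_le_mul_of_nonneg_left h6 (mul_nonneg hC0 (by linarith)))
    -- maximum of the quotient
    have hqc : ContinuousOn (fun x => d x / B x) S :=
      hdc.div hBc.continuousOn (fun x hx => (hBpos x (hSΩ hx)).ne')
    have hSne : S.Nonempty := ⟨x₀, by simpa [hS] using subset_closure hx₀⟩
    obtain ⟨y, hyS, hymax⟩ := hSc.exists_isMaxOn hSne hqc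
    set m : ℝ := d y / B y with hm
    have hBy := hBpos y (hSΩ hyS)
    have hdy : d y = m * B y := by rw [hm]; field_simp
    suffices hmC : m ≤ C * (t - 1) by
      intro x hx
      have hxS : x ∈ S := hx
      have hBx := hBpos x (hSΩ hxS)
      have h1 : d x / B x ≤ m := hymax hxS
      rw [div_le_iff₀ hBx] at h1
      exact h1.trans (mul_le_mul_of_nonneg_right hmC hBx.le)
    by_contra! hmC
    have hm0 : 0 < m := lt_of_le_of_lt (mul_nonneg hC0 (by linarith)) hmC
    have hd0 : 0 < d y := by rw [hdy]; positivity
    have huy := hupos y (hSΩ hyS)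
    set y' := x₀ + t • (y - x₀) with hy'
    have hsu : u y < t ^ a * u y' := by
      have : 0 < t ^ a * u y' - u y := hd0
      linarith
    have huy' : 0 < u y' := by
      by_contra! h
      have := mul_nonpos_of_nonneg_of_nonpos hTpos.le h
      linarith
    have hy'Ω : y' ∈ Ω := by
      by_contra h
      have := hfr y' hyS h
      linarith
    have hy'K : y' ∉ K := by
      intro h
      have := hcomp y h
      rw [hdy] at this
      have := le_of_mul_le_mul_right this hBy
      linarith
    have huε : u y' < ε := by
      by_contra! h
      exact hy'K ⟨hyS, h⟩
    have hloc : IsLocalMax (fun x => d x - m * B x) y := by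
      have hcont : ContinuousAt (fun x => x₀ + t • (x - x₀)) y := by fun_prop
      filter_upwards [hcont.eventually (hΩ.eventually_mem hy'Ω)] with x hx
      have hxS : x ∈ S := subset_closure hx
      have hBx := hBpos x (hSΩ hxS)
      have h1 : d x / B x ≤ m := hymax hxS
      rw [div_le_iff₀ hBx] at h1
      rw [hdy]
      linarith
    have hc1 : ContDiffAt ℝ 2 (fun x => t ^ a * u (x₀ + t • (x - x₀))) y := by
      refine contDiffAt_const.mul ?_
      refine ContDiffAt.comp y (g := u) (f := fun x => x₀ + t • (x - x₀)) (hu2 y' hy'Ω) ?_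
      fun_prop
    have hc2 : ContDiffAt ℝ 2 u y := hu2 y (hSΩ hyS)
    have hc3 : ContDiffAt ℝ 2 (fun x => m * B x) y := by
      simp only [hB]
      have := f.contDiff (n := 2)
      fun_prop
    have hlap := aux_lapn_max ((hc1.sub hc2).sub hc3) hloc
    have e1 : lapn n (fun x => d x - m * B x) y =
        t ^ a * t ^ 2 * lapn n u y' - lapn n u y - (-2 * m * κ) := by
      rw [aux_lapn_sub (f := d) (hc1.sub hc2) hc3]
      simp only [hd]
      rw [aux_lapn_sub hc1 hc2, aux_lapn_dil x₀ t (t ^ a) (hu2 y' hy'Ω)]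
      simp only [hB]
      rw [aux_lapn_barrier]
    have hlap' : lapn n (fun x => d x - m * B x) y ≤ 0 := hlap
    rw [e1] at hlap'
    have q1 := hueq y (hSΩ hyS)
    have q2 := hueq y' hy'Ω
    set s := t ^ a * u y' with hs
    have hsp : s ^ p = t ^ a * t ^ 2 * u y' ^ p := by
      rw [hs, Real.mul_rpow hTpos.le huy'.le, ← Real.rpow_mul ht0.le, hap, Real.rpow_add ht0]
      norm_num
    have q3 : t ^ a * t ^ 2 * lapn n u y' = lam * t ^ 2 * s - s ^ p := by
      rw [hsp, hs, ← q2]; ring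
    have q4 : lapn n u y = lam * u y - u y ^ p := by linarith
    rw [q3, q4] at hlap'
    have q5 : 0 ≤ lam * (t ^ 2 * s - u y) := by
      refine mul_nonneg hlam ?_
      have hspos : 0 < s := huy.trans hsu
      have h1t : 1 ≤ t ^ 2 := one_le_pow₀ ht1.le
      have := le_mul_of_one_le_left hspos.le h1t
      linarith
    have q6 := aux_conv_ineq hp huy hsu
    have q7 : s - u y = m * B y := by rw [← hdy]
    rw [q7] at q6
    have q8 : p * s ^ (p - 1) ≤ p * ((2 : ℝ) ^ a * ε) ^ (p - 1) := by
      refine mul_le_mul_of_nonneg_left ?_ (by linarith)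
      refine Real.rpow_le_rpow (huy.trans hsu).le ?_ hp1.le
      exact mul_le_mul (Real.rpow_le_rpow ht0.le ht2.le ha0.le) huε.le huy'.le (by positivity)
    have q9 : p * s ^ (p - 1) * (m * B y) ≤ p * ((2 : ℝ) ^ a * ε) ^ (p - 1) * (m * D ^ 2) :=
      mul_le_mul q8 (mul_le_mul_of_nonneg_left (hBle y (hSΩ hyS)) hm0.le) (by positivity)
        (by positivity)
    have q10 := mul_lt_mul_of_pos_right hεκ hm0
    linarith
  refine ⟨fun x => C * B x, continuous_const.mul hBc, by simp [hB], fun x hx => ?_⟩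
  have hder : HasDerivAt (fun s : ℝ => s ^ a * u (x₀ + s • (x - x₀))) (w x) 1 := by
    have := aux_dil_deriv (u := u) x₀ x a one_pos (by simpa using hudiff x hx)
    simpa [hw] using this
  have hsl := (hasDerivAt_iff_tendsto_slope.1 hder).mono_left
    (nhdsWithin_mono 1 (fun s (hs : s ∈ Set.Ioi 1) => ne_of_gt hs))
  refine le_of_tendsto hsl ?_
  have hcont : ContinuousAt (fun t : ℝ => x₀ + t • (x - x₀)) 1 := by fun_prop
  have h1 : ∀ᶠ t in 𝓝 (1 : ℝ), x₀ + t • (x - x₀) ∈ Ω :=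
    hcont.eventually (hΩ.eventually_mem (by simpa using hx))
  filter_upwards [self_mem_nhdsWithin, nhdsWithin_le_nhds h1,
    nhdsWithin_le_nhds (gt_mem_nhds (one_lt_two))] with t ht1 ht2 ht3
  have ht1' : 1 < t := ht1
  have := key t ht1' ht3 x (subset_closure ht2)
  rw [slope_def_field, div_le_iff₀ (by linarith)]
  simp only [Real.one_rpow, one_smul, add_sub_cancel, one_mul]
  linarith
/-- Grossi–Molle criterion. Under assumptions (i),(ii),(iii) on a
neighbourhood `W` of the maximum point `x₀`, one has `(x-x₀)·∇u(x) < 0` in `Ω \ {x₀}`,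
and `x₀` is the unique critical point of `u` in `Ω`. -/
theorem stmt11 (n : ℕ) (Ω W : Set (EuclideanSpace ℝ (Fin n)))
    (hΩ : IsOpen Ω) (hbd : Bornology.IsBounded Ω) (hconv : Convex ℝ Ω)
    (p lam : ℝ) (hp : 1 < p) (hlam : 0 ≤ lam)
    (u : EuclideanSpace ℝ (Fin n) → ℝ)
    (hu3 : ContDiffOn ℝ 3 u Ω) (hu1 : ContinuousOn u (closure Ω))
    (hupos : ∀ x ∈ Ω, 0 < u x)
    (hueq : ∀ x ∈ Ω, -lapn n u x + lam * u x = u x ^ p)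
    (hub : ∀ x ∈ frontier Ω, u x = 0)
    (x₀ : EuclideanSpace ℝ (Fin n)) (hx₀ : x₀ ∈ Ω)
    (hmax : ∀ x ∈ Ω, u x ≤ u x₀)
    (hW : IsOpen W) (hWΩ : W ⊆ Ω) (hx₀W : x₀ ∈ W)
    (hi : ∀ x ∈ W, x ≠ x₀ → ⟪x - x₀, gradient u x⟫ < 0)
    (hii : ∀ x ∈ frontier W, ⟪x - x₀, gradient u x⟫ + (2 / (p - 1)) * u x < 0)
    (hiii : ∃ μ > (0 : ℝ), ∀ φ : EuclideanSpace ℝ (Fin n) → ℝ,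
      ContDiff ℝ (⊤ : ℕ∞) φ → HasCompactSupport φ → tsupport φ ⊆ Ω \ closure W →
      μ * ∫ x in Ω \ closure W, (φ x) ^ 2 ≤
        (∫ x in Ω \ closure W, ‖gradient φ x‖ ^ 2) -
          ∫ x in Ω \ closure W, p * u x ^ (p - 1) * (φ x) ^ 2) :
    (∀ x ∈ Ω, x ≠ x₀ → ⟪x - x₀, gradient u x⟫ < 0) ∧
    (∀ x ∈ Ω, gradient u x = 0 → x = x₀) := by
  have hp1 : 0 < p - 1 := by linarith
  have ha0 : 0 < 2 / (p - 1) := by positivity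
  have main : ∀ x ∈ Ω, x ≠ x₀ → ⟪x - x₀, gradient u x⟫ < 0 := by
    obtain ⟨μ, hμ, H⟩ := hiii
    simp_rw [aux_inner_gradient] at hi hii ⊢
    have hUo : IsOpen (Ω \ closure W) := hΩ.sdiff isClosed_closure
    have hUΩ : Ω \ closure W ⊆ Ω := Set.sdiff_subset
    set w : EuclideanSpace ℝ (Fin n) → ℝ :=
      fun x => fderiv ℝ u x (x - x₀) + 2 / (p - 1) * u x with hw
    have hw2 : ContDiffOn ℝ 2 w Ω :=
      ((hu3.fderiv_of_isOpen hΩ (by norm_num)).clm_apply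
        (contDiffOn_id.sub contDiffOn_const)).add
        (contDiffOn_const.mul (hu3.of_le (by norm_num)))
    have hK : ∀ η > 0, IsCompact {x ∈ Ω \ closure W | η ≤ w x} := by
      intro η hη
      refine Metric.isCompact_of_isClosed_isBounded ?_ (hbd.subset fun x hx => hx.1.1)
      refine isClosed_of_closure_subset fun x hx => ?_
      have hxcl : x ∈ closure Ω := closure_mono (fun y hy => hy.1.1) hx
      have hxΩ : x ∈ Ω := by
        by_contra h
        obtain ⟨b, hb, hb0, hbw⟩ := aux_barrier hΩ hbd hconv hp hlam hu3 hu1 hupos hueq hub hx₀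
          (z := x) (by rw [hΩ.frontier_eq]; exact ⟨hxcl, h⟩)
        have hcl : x ∈ {y | η ≤ b y} := by
          refine closure_minimal ?_ (isClosed_le continuous_const hb) hx
          intro y hy
          exact hy.2.trans (hbw y hy.1.1)
        have : η ≤ b x := hcl
        linarith
      have hwx : η ≤ w x := by
        by_contra! h
        have h1 : ∀ᶠ y in 𝓝 x, w y < η :=
          (hw2.continuousOn.continuousAt (hΩ.mem_nhds hxΩ)).eventually (gt_mem_nhds h)
        obtain ⟨y, h2, h3⟩ := ((mem_closure_iff_frequently.1 hx).and_eventually h1).exists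
        linarith [h2.2]
      refine ⟨⟨hxΩ, fun hxW => ?_⟩, hwx⟩
      have hxnW : x ∉ W := by
        have : x ∈ Wᶜ := closure_minimal (fun y hy hyW => hy.1.2 (subset_closure hyW))
          hW.isClosed_compl hx
        exact this
      have := hii x (by rw [hW.frontier_eq]; exact ⟨hxW, hxnW⟩)
      have h5 : w x < 0 := this
      linarith
    have hneg : ∀ x ∈ Ω \ closure W, w x ≤ 0 := by
      refine aux_nonpos hUo (hbd.subset hUΩ) (c := fun x => p * u x ^ (p - 1))
        (M := p * u x₀ ^ (p - 1)) ?_ ?_ ?_ hμ H (hw2.mono hUΩ) ?_ hK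
      · exact continuousOn_const.mul ((hu3.continuousOn.mono hUΩ).rpow_const
          (fun _ _ => Or.inr hp1.le))
      · intro x hx
        exact mul_nonneg (by linarith) (Real.rpow_nonneg (hupos x hx.1).le _)
      · intro x hx
        exact mul_le_mul_of_nonneg_left
          (Real.rpow_le_rpow (hupos x hx.1).le (hmax x hx.1) hp1.le) (by linarith)
      · intro x hx hwx
        have h1 : lapn n w x = (lam - p * u x ^ (p - 1)) * w x + 2 * lam * u x :=
          aux_lapn_w hΩ hu3 hp hupos hueq x₀ hx.1
        rw [h1]
        have h2 := mul_nonneg hlam hwx.le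
        have h3 := mul_nonneg hlam (hupos x hx.1).le
        linarith
    intro x hx hne
    have hux := mul_pos ha0 (hupos x hx)
    by_cases hxW : x ∈ W
    · exact hi x hxW hne
    · by_cases hxc : x ∈ closure W
      · have := hii x (by rw [hW.frontier_eq]; exact ⟨hxc, hxW⟩)
        linarith
      · have : fderiv ℝ u x (x - x₀) + 2 / (p - 1) * u x ≤ 0 := hneg x ⟨hx, hxc⟩
        linarith
  refine ⟨main, fun x hx hg => ?_⟩
  by_contra hne
  have := main x hx hne
  rw [hg, inner_zero_right] at this
  exact lt_irrefl _ this
end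

section
/- Let Ω ⊂ ℝ² be a bounded domain. For every t ≥ 2 there is a constant D_t such that ‖u‖_{L^t(Ω)} ≤ D_t t^{1/2} ‖∇u‖_{L²(Ω)} for all u ∈ H¹₀(Ω), and the constants can be chosen so that D_t → (8πe)^{-1/2} as t → ∞. -/
open MeasureTheory Real

noncomputable def ev (θ : ℝ) : EuclideanSpace ℝ (Fin 2) :=
  Complex.orthonormalBasisOneI.repr (Real.cos θ + Real.sin θ * Complex.I)

lemma norm_ev (θ : ℝ) : ‖ev θ‖ = 1 := by
  unfold ev
  rw [LinearIsometryEquiv.norm_map]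
  have := Complex.norm_exp_ofReal_mul_I θ
  rw [Complex.exp_mul_I] at this
  simp

lemma continuous_ev : Continuous ev := by
  unfold ev
  fun_prop

lemma lintegral_polar (F : EuclideanSpace ℝ (Fin 2) → ENNReal) (hF : Measurable F) :
    ∫⁻ x, F x = ∫⁻ θ in Set.Ioo (-π) π, ∫⁻ r in Set.Ioi (0:ℝ), ENNReal.ofReal r * F (r • ev θ) := by
  have h1 := (Complex.orthonormalBasisOneI.repr.measurePreserving).lintegral_comp hF
  rw [← h1, ← Complex.lintegral_comp_polarCoord_symm]
  have h2 : polarCoord.target = Set.Ioi (0:ℝ) ×ˢ Set.Ioo (-π) π := rfl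
  rw [h2, Measure.volume_eq_prod, ← Measure.prod_restrict, lintegral_prod_symm]
  · refine lintegral_congr fun θ => lintegral_congr fun r => ?_
    rw [Complex.polarCoord_symm_apply, smul_eq_mul]
    congr 2
    unfold ev
    rw [← Complex.real_smul, map_smul]
  · have : (fun p : ℝ × ℝ => ENNReal.ofReal p.1 • F (Complex.orthonormalBasisOneI.repr (Complex.polarCoord.symm p)))
       = fun p : ℝ × ℝ => ENNReal.ofReal p.1 * F (p.1 • ev p.2) := by
      funext p
      rw [Complex.polarCoord_symm_apply, smul_eq_mul]
      congr 2
      unfold ev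
      rw [← Complex.real_smul, map_smul]
    rw [this]
    have := continuous_ev
    have h3 : Measurable (fun p : ℝ × ℝ => p.1 • ev p.2) := by
      apply Continuous.measurable; fun_prop
    exact ((ENNReal.measurable_ofReal.comp measurable_fst).mul (hF.comp h3)).aemeasurable

lemma lintegral_radial (φ : ℝ → ENNReal) (hφ : Measurable φ) (x : EuclideanSpace ℝ (Fin 2)) :
    ∫⁻ y, φ ‖x - y‖ = ENNReal.ofReal (2 * π) * ∫⁻ r in Set.Ioi (0:ℝ), ENNReal.ofReal r * φ r := by
  rw [lintegral_sub_left_eq_self (fun y : EuclideanSpace ℝ (Fin 2) => φ ‖y‖) x]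
  rw [lintegral_polar _ (by fun_prop)]
  have : ∀ θ : ℝ, ∫⁻ r in Set.Ioi (0:ℝ), ENNReal.ofReal r * φ ‖r • ev θ‖
      = ∫⁻ r in Set.Ioi (0:ℝ), ENNReal.ofReal r * φ r := by
    intro θ
    refine setLIntegral_congr_fun measurableSet_Ioi fun r hr => ?_
    simp only [norm_smul, norm_ev, mul_one, Real.norm_eq_abs, abs_of_pos (Set.mem_Ioi.1 hr)]
  simp_rw [this]
  rw [lintegral_const]
  simp [mul_comm]
  congr 2; ring

lemma grad_bound (u : EuclideanSpace ℝ (Fin 2) → ℝ) (hu : ContDiff ℝ (⊤ : ℕ∞) u)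
    (hc : HasCompactSupport u) (x : EuclideanSpace ℝ (Fin 2)) :
    ENNReal.ofReal (2 * π) * ‖u x‖ₑ ≤ ∫⁻ y, ‖gradient u y‖ₑ * (‖x - y‖ₑ)⁻¹ := by
  have hg : Continuous (gradient u) := by
    unfold gradient
    exact (LinearIsometryEquiv.continuous _).comp (hu.continuous_fderiv (by simp))
  have hm : Measurable fun y => ‖gradient u (x - y)‖ₑ * (‖y‖ₑ)⁻¹ := by fun_prop
  have h0 := lintegral_sub_left_eq_self (μ := volume) (fun y => ‖gradient u y‖ₑ * (‖x - y‖ₑ)⁻¹) x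
  simp only [sub_sub_cancel] at h0
  rw [← h0, lintegral_polar _ hm]
  have key : ∀ θ : ℝ, ‖u x‖ₑ ≤ ∫⁻ r in Set.Ioi (0:ℝ), ENNReal.ofReal r *
      (‖gradient u (x - r • ev θ)‖ₑ * (‖r • ev θ‖ₑ)⁻¹) := by
    intro θ
    have e1 : ∫⁻ r in Set.Ioi (0:ℝ), ENNReal.ofReal r *
      (‖gradient u (x - r • ev θ)‖ₑ * (‖r • ev θ‖ₑ)⁻¹) = 
       ∫⁻ r in Set.Ioi (0:ℝ), ‖gradient u (x - r • ev θ)‖ₑ := by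
      refine setLIntegral_congr_fun measurableSet_Ioi fun r hr => ?_
      have hr : 0 < r := hr
      have : ‖r • ev θ‖ₑ = ENNReal.ofReal r := by
        rw [← ofReal_norm, norm_smul, norm_ev, mul_one, Real.norm_eq_abs, abs_of_pos hr]
      simp only [this]
      rw [mul_comm, mul_assoc, ENNReal.inv_mul_cancel (by simpa using hr) (by simp), mul_one]
    rw [e1]
    set f : ℝ → ℝ := fun r => u (x - r • ev θ) with hf
    have hfd : ContDiff ℝ 1 f := by
      have : ContDiff ℝ 1 u := hu.of_le (by simp)
      fun_prop
    have hfc : HasCompactSupport f := by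
      apply hc.comp_isClosedEmbedding
      have : Isometry (fun r : ℝ => x - r • ev θ) := by
        apply Isometry.of_dist_eq
        intro a b
        rw [dist_sub_left, dist_eq_norm, ← sub_smul, norm_smul, norm_ev, mul_one, dist_eq_norm]
      exact this.isClosedEmbedding
    have hd : ∀ r, HasDerivAt f (fderiv ℝ u (x - r • ev θ) (-(ev θ))) r := by
      intro r
      have h1 : HasFDerivAt u (fderiv ℝ u (x - r • ev θ)) (x - r • ev θ) :=
        (hu.differentiable (by simp) _).hasFDerivAt
      refine h1.comp_hasDerivAt r ?_
      have := ((hasDerivAt_id r).smul_const (ev θ)).const_sub x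
      simpa using this
    have h2 := hfc.integral_Ioi_deriv_eq hfd 0
    have h3 : f 0 = u x := by simp [hf]
    calc ‖u x‖ₑ = ‖∫ r in Set.Ioi (0:ℝ), deriv f r‖ₑ := by rw [h2, h3, enorm_neg]
      _ ≤ ∫⁻ r in Set.Ioi (0:ℝ), ‖deriv f r‖ₑ := enorm_integral_le_lintegral_enorm _
      _ ≤ _ := by
        refine lintegral_mono fun r => ?_
        rw [(hd r).deriv]
        rw [enorm_le_iff_norm_le]
        refine (ContinuousLinearMap.le_opNorm _ _).trans ?_
        rw [norm_neg, norm_ev, mul_one]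
        simp [gradient]
  calc _ = ∫⁻ θ in Set.Ioo (-π) π, ‖u x‖ₑ := by
        rw [lintegral_const]; simp [mul_comm]; congr 2; ring
    _ ≤ _ := lintegral_mono fun θ => key θ

lemma young_form {α : Type*} [MeasurableSpace α] (μ : Measure α) [SFinite μ]
    (k : α → α → ENNReal) (hkm : Measurable (Function.uncurry k)) (hsymm : ∀ x y, k x y = k y x)
    (h : α → ENNReal) (hh : Measurable h) (t : ℝ) (ht : 2 ≤ t) (κ : ENNReal)
    (hκ : ∀ᵐ x ∂μ, ∫⁻ y, k x y ^ (t / 2) ∂μ ≤ κ) :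
    ∫⁻ x, ∫⁻ y, h x ^ (t - 1) * h y ^ (t - 1) * k x y ∂μ ∂μ ≤
      (∫⁻ x, h x ^ t ∂μ) ^ (2 - 2 / t) * κ ^ (2 / t) := by
  have ht0 : 0 < t := by linarith
  set A := ∫⁻ x, h x ^ t ∂μ with hA
  let F : Fin 3 → α × α → ENNReal := ![fun p => h p.1 ^ t * k p.1 p.2 ^ (t / 2),
    fun p => h p.2 ^ t * k p.1 p.2 ^ (t / 2), fun p => h p.1 ^ t * h p.2 ^ t]
  let P : Fin 3 → ℝ := ![1 / t, 1 / t, 1 - 2 / t]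
  have hk' : Measurable fun p : α × α => k p.1 p.2 := hkm
  have m0 : Measurable (fun p : α × α => h p.1 ^ t * k p.1 p.2 ^ (t / 2)) := by fun_prop
  have m1 : Measurable (fun p : α × α => h p.2 ^ t * k p.1 p.2 ^ (t / 2)) := by fun_prop
  have m2 : Measurable (fun p : α × α => h p.1 ^ t * h p.2 ^ t) := by fun_prop
  have h2t : 2 / t ≤ 1 := by rw [div_le_one ht0]; exact ht
  have H := ENNReal.lintegral_prod_norm_pow_le (μ := μ.prod μ) Finset.univ (f := F) (p := P)
    (by
      intro i _
      fin_cases i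
      · exact m0.aemeasurable
      · exact m1.aemeasurable
      · exact m2.aemeasurable)
    (by simp [P, Fin.sum_univ_three]; ring)
    (by
      intro i _
      fin_cases i
      · simp [P]; positivity
      · simp [P]; positivity
      · simpa [P] using h2t)
  simp only [Fin.prod_univ_three, F, P, Matrix.cons_val_zero, Matrix.cons_val_one, Matrix.cons_val] at H
  have b0 : ∫⁻ p, h p.1 ^ t * k p.1 p.2 ^ (t / 2) ∂(μ.prod μ) ≤ A * κ := by
    rw [lintegral_prod _ m0.aemeasurable, hA, ← lintegral_mul_const _ (by fun_prop)]
    refine lintegral_mono_ae ?_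
    filter_upwards [hκ] with x hx
    rw [lintegral_const_mul _ (by fun_prop)]
    gcongr
  have b1 : ∫⁻ p, h p.2 ^ t * k p.1 p.2 ^ (t / 2) ∂(μ.prod μ) ≤ A * κ := by
    rw [lintegral_prod_symm _ m1.aemeasurable, hA, ← lintegral_mul_const _ (by fun_prop)]
    refine lintegral_mono_ae ?_
    filter_upwards [hκ] with x hx
    simp_rw [hsymm _ x]
    rw [lintegral_const_mul _ (by fun_prop)]
    gcongr
  have b2 : ∫⁻ p, h p.1 ^ t * h p.2 ^ t ∂(μ.prod μ) = A * A := by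
    rw [lintegral_prod_mul (f := fun x => h x ^ t) (g := fun x => h x ^ t) (by fun_prop) (by fun_prop)]
  rw [b2] at H
  have hpt : ∀ p : α × α, h p.1 ^ (t-1) * h p.2 ^ (t-1) * k p.1 p.2 =
      (h p.1 ^ t * k p.1 p.2 ^ (t / 2)) ^ (1/t) * (h p.2 ^ t * k p.1 p.2 ^ (t / 2)) ^ (1/t) *
        (h p.1 ^ t * h p.2 ^ t) ^ (1 - 2 / t) := by
    intro p
    have e1 : t / 2 * (1 / t) = 1 / 2 := by field_simp
    have e2 : t * (1 / t) = 1 := by field_simp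
    have e3 : t * (1 - 2 / t) = t - 2 := by field_simp
    rw [ENNReal.mul_rpow_of_nonneg _ _ (by positivity), ENNReal.mul_rpow_of_nonneg _ _ (by positivity),
      ENNReal.mul_rpow_of_nonneg _ _ (by linarith)]
    simp only [← ENNReal.rpow_mul, e1, e2, e3, ENNReal.rpow_one]
    have q1 : ∀ a : ENNReal, a ^ (t - 1) = a * a ^ (t - 2) := by
      intro a
      rw [show t - 1 = 1 + (t - 2) by ring, ENNReal.rpow_add_of_nonneg _ _ (by norm_num) (by linarith),
        ENNReal.rpow_one]
    have q2 : k p.1 p.2 = k p.1 p.2 ^ (1/2 : ℝ) * k p.1 p.2 ^ (1/2 : ℝ) := by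
      rw [← ENNReal.rpow_add_of_nonneg _ _ (by norm_num) (by norm_num)]; norm_num
    rw [q1, q1]
    nth_rewrite 1 [q2]
    ring
  have m3 : Measurable (fun p : α × α => h p.1 ^ (t-1) * h p.2 ^ (t-1) * k p.1 p.2) := by fun_prop
  rw [← lintegral_prod (fun p : α × α => h p.1 ^ (t-1) * h p.2 ^ (t-1) * k p.1 p.2) m3.aemeasurable,
    lintegral_congr hpt]
  refine H.trans ?_
  have h1t : 0 ≤ 1 / t := by positivity
  calc _ ≤ (A * κ) ^ (1/t) * (A * κ) ^ (1/t) * (A * A) ^ (1 - 2 / t) := by gcongr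
    _ = _ := by
      have n2 : 0 ≤ 1 - 2 / t := by linarith
      rw [ENNReal.mul_rpow_of_nonneg _ _ h1t, ENNReal.mul_rpow_of_nonneg _ _ n2]
      rw [show 2 - 2 / t = 1/t + 1/t + (1 - 2/t) + (1 - 2/t) by ring, show 2 / t = 1 / t + 1/ t by ring]
      rw [show 1 - (1 / t + 1 / t) = 1 - 2 / t by ring]
      rw [ENNReal.rpow_add_of_nonneg _ _ (by positivity) n2,
        ENNReal.rpow_add_of_nonneg _ _ (by positivity) n2,
        ENNReal.rpow_add_of_nonneg _ _ h1t h1t, ENNReal.rpow_add_of_nonneg _ _ h1t h1t]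
      ring

lemma duality {α : Type*} [MeasurableSpace α] (μ : Measure α) [SFinite μ]
    (N : α → α → ENNReal) (hN : Measurable (Function.uncurry N))
    (h f : α → ENNReal) (hh : Measurable h) (hf : Measurable f) (t : ℝ) (ht : 2 ≤ t) (κ c : ENNReal)
    (hκ : ∀ᵐ x ∂μ, ∫⁻ x', (∫⁻ y, N x y * N x' y ∂μ) ^ (t / 2) ∂μ ≤ κ)
    (hrep : ∀ x, c * h x ≤ ∫⁻ y, f y * N x y ∂μ) :
    c * ∫⁻ x, h x ^ t ∂μ ≤ (∫⁻ y, f y ^ (2:ℝ) ∂μ) ^ (1 / 2 : ℝ) *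
      ((∫⁻ x, h x ^ t ∂μ) ^ (2 - 2 / t) * κ ^ (2 / t)) ^ (1 / 2 : ℝ) := by
  have hN' : Measurable fun p : α × α => N p.1 p.2 := hN
  have hN2 : Measurable fun p : α × α => N p.2 p.1 := hN'.comp measurable_swap
  have hk : Measurable (Function.uncurry fun x x' => ∫⁻ y, N x y * N x' y ∂μ) := by
    apply Measurable.lintegral_prod_right'
      (f := fun q : (α × α) × α => N q.1.1 q.2 * N q.1.2 q.2)
    apply Measurable.mul
    · exact hN'.comp (by fun_prop : Measurable fun q : (α × α) × α => (q.1.1, q.2))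
    · exact hN'.comp (by fun_prop : Measurable fun q : (α × α) × α => (q.1.2, q.2))
  have Y := young_form μ (fun x x' => ∫⁻ y, N x y * N x' y ∂μ) hk
    (fun x y => by simp_rw [mul_comm]) h hh t ht κ hκ
  set V : α → ENNReal := fun y => ∫⁻ x, h x ^ (t-1) * N x y ∂μ with hV
  have mV : Measurable V := by
    apply Measurable.lintegral_prod_right' (f := fun q : α × α => h q.2 ^ (t-1) * N q.2 q.1)
    fun_prop
  have s1 : c * ∫⁻ x, h x ^ t ∂μ ≤ ∫⁻ y, f y * V y ∂μ := by
    rw [← lintegral_const_mul _ (by fun_prop)]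
    calc _ = ∫⁻ x, h x ^ (t-1) * (c * h x) ∂μ := by
          refine lintegral_congr fun x => ?_
          rw [show t = (t - 1) + 1 by ring, ENNReal.rpow_add_of_nonneg _ _ (by linarith) (by norm_num),
            ENNReal.rpow_one, show t - 1 + 1 - 1 = t - 1 by ring]
          ring
      _ ≤ ∫⁻ x, h x ^ (t-1) * ∫⁻ y, f y * N x y ∂μ ∂μ := by
          gcongr with x; exact hrep x
      _ = ∫⁻ x, ∫⁻ y, f y * (h x ^ (t-1) *  N x y) ∂μ ∂μ := by
          refine lintegral_congr fun x => ?_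
          rw [← lintegral_const_mul _ (by fun_prop)]
          refine lintegral_congr fun y => ?_
          ring
      _ = ∫⁻ y, ∫⁻ x, f y * (h x ^ (t-1) *  N x y) ∂μ ∂μ := by
          rw [lintegral_lintegral_swap]
          apply Measurable.aemeasurable
          change Measurable fun p : α × α => f p.2 * (h p.1 ^ (t-1) * N p.1 p.2)
          fun_prop
      _ = _ := by
          refine lintegral_congr fun y => ?_
          rw [lintegral_const_mul _ (by fun_prop)]
  have s2 := ENNReal.lintegral_mul_le_Lp_mul_Lq μ Real.HolderConjugate.two_two hf.aemeasurable mV.aemeasurable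
  have s3 : ∫⁻ y, V y ^ (2:ℝ) ∂μ = ∫⁻ x, ∫⁻ x', h x ^ (t - 1) * h x' ^ (t - 1) * ∫⁻ y, N x y * N x' y ∂μ ∂μ ∂μ := by
    calc _ = ∫⁻ y, ∫⁻ x, ∫⁻ x', (h x ^ (t-1) * N x y) * (h x' ^ (t-1) * N x' y) ∂μ ∂μ ∂μ := by
          refine lintegral_congr fun y => ?_
          rw [ENNReal.rpow_two, sq]
          nth_rewrite 1 [hV]
          rw [← lintegral_mul_const _ (by fun_prop)]
          refine lintegral_congr fun x => ?_
          rw [← lintegral_const_mul _ (by fun_prop)]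
      _ = ∫⁻ x, ∫⁻ y, ∫⁻ x', (h x ^ (t-1) * N x y) * (h x' ^ (t-1) * N x' y) ∂μ ∂μ ∂μ := by
          rw [lintegral_lintegral_swap]
          apply Measurable.aemeasurable
          apply Measurable.lintegral_prod_right' (f := fun q : (α × α) × α =>
            (h q.1.2 ^ (t-1) * N q.1.2 q.1.1) * (h q.2 ^ (t-1) * N q.2 q.1.1))
          have a1 := hN'.comp (by fun_prop : Measurable fun q : (α × α) × α => (q.1.2, q.1.1))
          have a2 := hN'.comp (by fun_prop : Measurable fun q : (α × α) × α => (q.2, q.1.1))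
          simp only [Function.comp_def] at a1 a2
          fun_prop
      _ = ∫⁻ x, ∫⁻ x', ∫⁻ y, (h x ^ (t-1) * N x y) * (h x' ^ (t-1) * N x' y) ∂μ ∂μ ∂μ := by
          refine lintegral_congr fun x => ?_
          rw [lintegral_lintegral_swap]
          apply Measurable.aemeasurable
          change Measurable fun q : α × α => (h x ^ (t-1) * N x q.1) * (h q.2 ^ (t-1) * N q.2 q.1)
          fun_prop
      _ = _ := by
          refine lintegral_congr fun x => lintegral_congr fun x' => ?_
          rw [← lintegral_const_mul _ (by fun_prop)]
          refine lintegral_congr fun y => ?_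
          ring
  refine s1.trans (s2.trans ?_)
  rw [s3]
  gcongr

lemma radial_near (x : EuclideanSpace ℝ (Fin 2)) (ρ a : ℝ) (hρ : 0 < ρ) (_ha : 0 < a) :
    ∫⁻ y, (Set.Iic (a * ρ)).indicator (fun r => ENNReal.ofReal (2 / ρ) * (ENNReal.ofReal r)⁻¹) ‖x - y‖
      = ENNReal.ofReal (4 * π * a) := by
  rw [lintegral_radial _ (by apply Measurable.indicator; · fun_prop
                             · exact measurableSet_Iic)]
  have : ∫⁻ r in Set.Ioi (0:ℝ), ENNReal.ofReal r * 
      (Set.Iic (a * ρ)).indicator (fun r => ENNReal.ofReal (2 / ρ) * (ENNReal.ofReal r)⁻¹) r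
      = ∫⁻ r in Set.Ioi (0:ℝ), (Set.Iic (a * ρ)).indicator (fun r => ENNReal.ofReal (2 / ρ)) r := by
    refine setLIntegral_congr_fun measurableSet_Ioi fun r hr => ?_
    have hr : 0 < r := hr
    by_cases h : r ∈ Set.Iic (a * ρ)
    · simp only [Set.indicator_of_mem h]
      rw [mul_comm, mul_assoc, ENNReal.inv_mul_cancel (by simpa using hr) (by simp), mul_one]
    · simp only [Set.indicator_of_notMem h, mul_zero]
  rw [this, lintegral_indicator measurableSet_Iic, Measure.restrict_restrict measurableSet_Iic,
    lintegral_const, Measure.restrict_apply_univ, Set.inter_comm, Set.Ioi_inter_Iic, Real.volume_Ioc,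
    ← ENNReal.ofReal_mul (by positivity), ← ENNReal.ofReal_mul (by positivity)]
  congr 1
  field_simp
  ring

lemma radial_far (x : EuclideanSpace ℝ (Fin 2)) (ρ R : ℝ) (hρ : 0 < ρ) (hR : ρ < R) :
    ∫⁻ y, (Set.Ioc (2 * ρ) (3 * R)).indicator (fun r => ENNReal.ofReal (r⁻¹ * (r - ρ)⁻¹)) ‖x - y‖
      ≤ ENNReal.ofReal (2 * π * Real.log (3 * R / ρ)) := by
  rw [lintegral_radial _ (by apply Measurable.indicator; · fun_prop
                             · exact measurableSet_Ioc)]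
  rw [ENNReal.ofReal_mul (q := Real.log (3 * R / ρ)) (by positivity)]
  gcongr
  have : ∫⁻ r in Set.Ioi (0:ℝ), ENNReal.ofReal r * 
      (Set.Ioc (2 * ρ) (3 * R)).indicator (fun r => ENNReal.ofReal (r⁻¹ * (r - ρ)⁻¹)) r
      = ∫⁻ r in Set.Ioi (0:ℝ), (Set.Ioc (2 * ρ) (3 * R)).indicator (fun r => ENNReal.ofReal ((r - ρ)⁻¹)) r := by
    refine setLIntegral_congr_fun measurableSet_Ioi fun r hr => ?_
    have hr : 0 < r := hr
    by_cases h : r ∈ Set.Ioc (2 * ρ) (3 * R)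
    · simp only [Set.indicator_of_mem h]
      rw [← ENNReal.ofReal_mul hr.le]
      congr 1
      field_simp
    · simp only [Set.indicator_of_notMem h, mul_zero]
  rw [this, lintegral_indicator measurableSet_Ioc, Measure.restrict_restrict measurableSet_Ioc]
  have e : Set.Ioc (2 * ρ) (3 * R) ∩ Set.Ioi 0 = Set.Ioc (2 * ρ) (3 * R) := by
    ext r; simp only [Set.mem_inter_iff, Set.mem_Ioc, Set.mem_Ioi]
    constructor
    · exact fun h => h.1
    · exact fun h => ⟨h, by linarith [h.1]⟩
  rw [e]
  have hle : 2 * ρ ≤ 3 * R := by linarith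
  have hint : IntervalIntegrable (fun r => (r - ρ)⁻¹) volume (2 * ρ) (3 * R) := by
    apply ContinuousOn.intervalIntegrable
    rw [Set.uIcc_of_le hle]
    apply ContinuousOn.inv₀ (by fun_prop)
    intro r hr
    have := hr.1
    intro h; linarith
  rw [← ofReal_integral_eq_lintegral_ofReal]
  · apply ENNReal.ofReal_le_ofReal
    rw [← intervalIntegral.integral_of_le hle,
      intervalIntegral.integral_comp_sub_right (fun r => r⁻¹), integral_inv_of_pos (by linarith) (by linarith)]
    apply Real.log_le_log
    · apply div_pos <;> linarith
    · rw [show 2 * ρ - ρ = ρ by ring]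
      gcongr; linarith
  · exact (intervalIntegrable_iff_integrableOn_Ioc_of_le hle).1 hint
  · filter_upwards [ae_restrict_mem measurableSet_Ioc] with r hr
    have := hr.1
    exact inv_nonneg.2 (by linarith)

lemma kernel_bound (Ω : Set (EuclideanSpace ℝ (Fin 2))) (hm : MeasurableSet Ω) (R : ℝ)
    (hR : ∀ x ∈ Ω, ∀ y ∈ Ω, ‖x - y‖ < R) (x x' : EuclideanSpace ℝ (Fin 2)) (hx : x ∈ Ω) (hx' : x' ∈ Ω)
    (hne : x ≠ x') :
    ∫⁻ y in Ω, (‖x - y‖ₑ)⁻¹ * (‖x' - y‖ₑ)⁻¹ ≤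
      ENNReal.ofReal (2 * π * Real.log (3 * R * Real.exp 10 / ‖x - x'‖)) := by
  set ρ := ‖x - x'‖ with hρd
  have hρ : 0 < ρ := norm_pos_iff.2 (sub_ne_zero.2 hne)
  have hρR : ρ < R := hR x hx x' hx'
  set φ1 : ℝ → ENNReal := (Set.Ioc (2 * ρ) (3 * R)).indicator (fun r => ENNReal.ofReal (r⁻¹ * (r - ρ)⁻¹)) with h1
  set φ2 : ℝ → ENNReal := (Set.Iic (2 * ρ)).indicator (fun r => ENNReal.ofReal (2 / ρ) * (ENNReal.ofReal r)⁻¹) with h2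
  set φ3 : ℝ → ENNReal := (Set.Iic (3 * ρ)).indicator (fun r => ENNReal.ofReal (2 / ρ) * (ENNReal.ofReal r)⁻¹) with h3
  have m1 : Measurable φ1 := by
    apply Measurable.indicator; · fun_prop
    · exact measurableSet_Ioc
  have m2 : Measurable φ2 := by
    apply Measurable.indicator; · fun_prop
    · exact measurableSet_Iic
  have hpt : ∀ y ∈ Ω, (‖x - y‖ₑ)⁻¹ * (‖x' - y‖ₑ)⁻¹ ≤ φ1 ‖x - y‖ + φ2 ‖x - y‖ + φ3 ‖x' - y‖ := by
    intro y hy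
    have ha : ‖x - y‖ < R := hR x hx y hy
    have t1 : ‖x - y‖ ≤ ρ + ‖x' - y‖ := by
      rw [show x - y = (x - x') + (x' - y) by abel]; exact norm_add_le _ _
    have t2 : ‖x' - y‖ ≤ ρ + ‖x - y‖ := by
      rw [show x' - y = -(x - x') + (x - y) by abel]
      exact (norm_add_le _ _).trans (by rw [norm_neg])
    have t3 : ρ ≤ ‖x - y‖ + ‖x' - y‖ := by
      rw [hρd, show x - x' = (x - y) - (x' - y) by abel]; exact norm_sub_le _ _
    have hinv : ∀ z : EuclideanSpace ℝ (Fin 2), ρ / 2 ≤ ‖z‖ → (‖z‖ₑ)⁻¹ ≤ ENNReal.ofReal (2 / ρ) := by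
      intro z hz
      rw [← ofReal_norm, ← ENNReal.ofReal_inv_of_pos (by linarith)]
      apply ENNReal.ofReal_le_ofReal
      rw [show 2 / ρ = (ρ / 2)⁻¹ by simp]
      gcongr
    by_cases hc : 2 * ρ < ‖x - y‖
    · have hmem : ‖x - y‖ ∈ Set.Ioc (2 * ρ) (3 * R) := ⟨hc, by linarith⟩
      rw [add_assoc]
      refine le_trans ?_ le_self_add
      rw [h1, Set.indicator_of_mem hmem, ← ofReal_norm, ← ofReal_norm,
        ← ENNReal.ofReal_inv_of_pos (by linarith), ← ENNReal.ofReal_inv_of_pos (by linarith),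
        ← ENNReal.ofReal_mul (by positivity)]
      apply ENNReal.ofReal_le_ofReal
      gcongr
      · linarith
      · linarith
    · push Not at hc
      by_cases hb : ρ / 2 ≤ ‖x' - y‖
      · refine le_trans (le_trans ?_ le_add_self) le_self_add
        rw [h2, Set.indicator_of_mem (by exact hc), mul_comm, ofReal_norm]
        gcongr
        exact hinv _ hb
      · push Not at hb
        refine le_trans ?_ le_add_self
        rw [h3, Set.indicator_of_mem (show ‖x' - y‖ ∈ Set.Iic (3 * ρ) by
          simp only [Set.mem_Iic]; linarith), ofReal_norm]
        gcongr
        exact hinv _ (by linarith)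
  calc _ ≤ ∫⁻ y in Ω, (φ1 ‖x - y‖ + φ2 ‖x - y‖ + φ3 ‖x' - y‖) := setLIntegral_mono' hm hpt
    _ ≤ ∫⁻ y, (φ1 ‖x - y‖ + φ2 ‖x - y‖ + φ3 ‖x' - y‖) := setLIntegral_le_lintegral _ _
    _ = (∫⁻ y, φ1 ‖x - y‖) + (∫⁻ y, φ2 ‖x - y‖) + ∫⁻ y, φ3 ‖x' - y‖ := by
      rw [lintegral_add_left (by fun_prop), lintegral_add_left (by fun_prop)]
    _ ≤ ENNReal.ofReal (2 * π * Real.log (3 * R / ρ)) + ENNReal.ofReal (4 * π * 2) + ENNReal.ofReal (4 * π * 3) := by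
      gcongr
      · exact radial_far x ρ R hρ hρR
      · exact (radial_near x ρ 2 hρ (by norm_num)).le
      · exact (radial_near x' ρ 3 hρ (by norm_num)).le
    _ = _ := by
      have l0 : 0 ≤ Real.log (3 * R / ρ) := by
        apply Real.log_nonneg; rw [le_div_iff₀ hρ]; linarith
      rw [← ENNReal.ofReal_add (by positivity) (by positivity), ← ENNReal.ofReal_add (by positivity) (by positivity)]
      congr 1
      rw [show 3 * R * Real.exp 10 / ρ = (3 * R / ρ) * Real.exp 10 by ring,
        Real.log_mul (by apply ne_of_gt; apply div_pos <;> linarith) (by positivity), Real.log_exp]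
      ring

lemma log_rpow_bound (y s β : ℝ) (hy : 1 ≤ y) (hs : 0 < s) (hβ : 0 < β) :
    Real.log y ^ s ≤ (s / (Real.exp 1 * β)) ^ s * y ^ β := by
  have hL : 0 ≤ Real.log y := Real.log_nonneg hy
  have h1 : Real.log y ≤ s / (Real.exp 1 * β) * y ^ (β / s) := by
    have := Real.add_one_le_exp (β * Real.log y / s - 1)
    rw [Real.rpow_def_of_pos (by linarith)]
    have e : Real.exp (β * Real.log y / s - 1) = Real.exp (Real.log y * (β / s)) / Real.exp 1 := by
      rw [← Real.exp_sub]; congr 1; ring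
    rw [e] at this
    have h2 : β * Real.log y / s ≤ Real.exp (Real.log y * (β / s)) / Real.exp 1 := by linarith
    calc Real.log y = s / β * (β * Real.log y / s) := by field_simp
      _ ≤ s / β * (Real.exp (Real.log y * (β / s)) / Real.exp 1) := by gcongr
      _ = _ := by field_simp
  calc _ ≤ (s / (Real.exp 1 * β) * y ^ (β / s)) ^ s := by gcongr
    _ = _ := by
      rw [Real.mul_rpow (by positivity) (by positivity), ← Real.rpow_mul (by linarith)]
      congr 2; field_simp

lemma radial_pow (x : EuclideanSpace ℝ (Fin 2)) (R β : ℝ) (hR : 0 < R) (hβ : β < 2) :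
    ∫⁻ y, (Set.Ioc 0 R).indicator (fun r => ENNReal.ofReal ((R / r) ^ β)) ‖x - y‖
      = ENNReal.ofReal (2 * π * R ^ 2 / (2 - β)) := by
  rw [lintegral_radial _ (by apply Measurable.indicator; · fun_prop
                             · exact measurableSet_Ioc)]
  have : ∫⁻ r in Set.Ioi (0:ℝ), ENNReal.ofReal r * 
      (Set.Ioc 0 R).indicator (fun r => ENNReal.ofReal ((R / r) ^ β)) r
      = ∫⁻ r in Set.Ioi (0:ℝ), (Set.Ioc 0 R).indicator (fun r => ENNReal.ofReal (R ^ β * r ^ (1 - β))) r := by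
    refine setLIntegral_congr_fun measurableSet_Ioi fun r hr => ?_
    have hr : 0 < r := hr
    by_cases h : r ∈ Set.Ioc 0 R
    · simp only [Set.indicator_of_mem h]
      rw [← ENNReal.ofReal_mul hr.le]
      congr 1
      rw [Real.div_rpow hR.le hr.le, Real.rpow_sub hr, Real.rpow_one]
      ring
    · simp only [Set.indicator_of_notMem h, mul_zero]
  rw [this, lintegral_indicator measurableSet_Ioc, Measure.restrict_restrict measurableSet_Ioc]
  have e : Set.Ioc 0 R ∩ Set.Ioi 0 = Set.Ioc 0 R := by
    ext r; simp only [Set.mem_inter_iff, Set.mem_Ioc, Set.mem_Ioi]; tauto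
  rw [e]
  have hint : IntervalIntegrable (fun r : ℝ => R ^ β * r ^ (1 - β)) volume 0 R :=
    (intervalIntegral.intervalIntegrable_rpow' (by linarith)).const_mul _
  rw [← ofReal_integral_eq_lintegral_ofReal]
  · rw [← intervalIntegral.integral_of_le hR.le, intervalIntegral.integral_const_mul,
      integral_rpow (Or.inl (by linarith)), ← ENNReal.ofReal_mul (by positivity)]
    congr 1
    rw [Real.zero_rpow (by linarith), sub_zero, show 1 - β + 1 = 2 - β by ring,
      ← mul_div_assoc (R ^ β), ← Real.rpow_add hR, show β + (2 - β) = 2 by ring, Real.rpow_two]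
    ring
  · exact (intervalIntegrable_iff_integrableOn_Ioc_of_le hR.le).1 hint
  · filter_upwards [ae_restrict_mem measurableSet_Ioc] with r hr
    have := hr.1
    simp only [Pi.zero_apply]; positivity

lemma kernel_pow (Ω : Set (EuclideanSpace ℝ (Fin 2))) (hm : MeasurableSet Ω) (R : ℝ) (hR0 : 0 < R)
    (hR : ∀ x ∈ Ω, ∀ y ∈ Ω, ‖x - y‖ < R) (s β : ℝ) (hs : 0 < s) (hβ : 0 < β) (hβ2 : β < 2)
    (x : EuclideanSpace ℝ (Fin 2)) (hx : x ∈ Ω) :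
    ∫⁻ x' in Ω, (∫⁻ y in Ω, (‖x - y‖ₑ)⁻¹ * (‖x' - y‖ₑ)⁻¹) ^ s ≤
      ENNReal.ofReal ((2 * π * (s / (Real.exp 1 * β))) ^ s * 
        (2 * π * (3 * R * Real.exp 10) ^ 2 / (2 - β))) := by
  set R' := 3 * R * Real.exp 10 with hR'
  have hR'0 : 0 < R' := by positivity
  have hRR' : R ≤ R' := by
    have := Real.add_one_le_exp (10:ℝ)
    rw [hR']; nlinarith
  set C := (2 * π * (s / (Real.exp 1 * β))) ^ s with hC
  have hC0 : 0 ≤ C := by positivity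
  calc _ ≤ ∫⁻ x' in Ω, ENNReal.ofReal C * 
        (Set.Ioc 0 R').indicator (fun r => ENNReal.ofReal ((R' / r) ^ β)) ‖x - x'‖ := by
        apply lintegral_mono_ae
        have hne : ∀ᵐ x' ∂(volume.restrict Ω), x' ≠ x := by
          apply ae_restrict_of_ae
          exact Measure.ae_ne volume x
        filter_upwards [ae_restrict_mem hm, hne] with x' hx' hn
        have hρ : 0 < ‖x - x'‖ := norm_pos_iff.2 (sub_ne_zero.2 hn.symm)
        have hρR := hR x hx x' hx'
        have hmem : ‖x - x'‖ ∈ Set.Ioc 0 R' := ⟨hρ, by linarith⟩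
        have h1 : 1 ≤ R' / ‖x - x'‖ := by rw [le_div_iff₀ hρ]; linarith
        have hL := Real.log_nonneg h1
        rw [Set.indicator_of_mem hmem, ← ENNReal.ofReal_mul hC0]
        refine (ENNReal.rpow_le_rpow (kernel_bound Ω hm R hR x x' hx hx' hn.symm) hs.le).trans ?_
        rw [ENNReal.ofReal_rpow_of_nonneg (by positivity) hs.le]
        apply ENNReal.ofReal_le_ofReal
        rw [Real.mul_rpow (by positivity) hL, hC,
          Real.mul_rpow (x := 2 * π) (y := s / (Real.exp 1 * β)) (by positivity) (by positivity), mul_assoc]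
        gcongr
        exact log_rpow_bound _ s β h1 hs hβ
    _ ≤ ∫⁻ x', ENNReal.ofReal C * 
        (Set.Ioc 0 R').indicator (fun r => ENNReal.ofReal ((R' / r) ^ β)) ‖x - x'‖ := setLIntegral_le_lintegral _ _
    _ = _ := by
      rw [lintegral_const_mul' _ _ (by simp), radial_pow x R' β hR'0 hβ2, ENNReal.ofReal_mul hC0]

lemma main_ineq (Ω : Set (EuclideanSpace ℝ (Fin 2))) (hΩ : IsOpen Ω) (R : ℝ) (hR0 : 0 < R)
    (hR : ∀ x ∈ Ω, ∀ y ∈ Ω, ‖x - y‖ < R) (t : ℝ) (ht : 2 ≤ t)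
    (u : EuclideanSpace ℝ (Fin 2) → ℝ) (hu : ContDiff ℝ (⊤ : ℕ∞) u) (hc : HasCompactSupport u)
    (hs : tsupport u ⊆ Ω) (κ : ℝ) (hκ0 : 0 ≤ κ)
    (hκ : κ = (2 * π * (t / 2 / (Real.exp 1 * (2 - 1 / t)))) ^ (t / 2) * 
        (2 * π * (3 * R * Real.exp 10) ^ 2 / (2 - (2 - 1 / t)))) :
    (∫ x in Ω, |u x| ^ t) ^ (1 / t) ≤
      (2 * π)⁻¹ * κ ^ (1 / t) * (∫ x in Ω, ‖gradient u x‖ ^ 2) ^ ((1 : ℝ) / 2) := by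
  have ht0 : 0 < t := by linarith
  have h1t : 1 / t ≤ 1 / 2 := by gcongr
  have h1t0 : 0 < 1 / t := by positivity
  have hg : Continuous (gradient u) := by
    unfold gradient
    exact (LinearIsometryEquiv.continuous _).comp (hu.continuous_fderiv (by simp))
  have hcu := hu.continuous
  have hgs : Function.support (gradient u) ⊆ tsupport u := by
    intro x hx
    apply support_fderiv_subset ℝ
    intro h
    apply hx
    simp [gradient, h]
  have hgc : HasCompactSupport (gradient u) := hc.mono' hgs
  have iA : Integrable (fun x => |u x| ^ t) (volume.restrict Ω) := by
    apply Integrable.restrict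
    apply Continuous.integrable_of_hasCompactSupport
    · exact hcu.abs.rpow_const (fun _ => Or.inr ht0.le)
    · apply hc.mono
      intro x hx h
      apply hx
      simp [h, Real.zero_rpow ht0.ne']
  have iG : Integrable (fun x => ‖gradient u x‖ ^ 2) (volume.restrict Ω) := by
    apply Integrable.restrict
    apply Continuous.integrable_of_hasCompactSupport
    · fun_prop
    · apply hgc.mono
      intro x hx h
      apply hx
      simp [h]
  set A := ∫ x in Ω, |u x| ^ t with hA
  set G := ∫ x in Ω, ‖gradient u x‖ ^ 2 with hG
  have hA0 : 0 ≤ A := integral_nonneg fun x => by positivity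
  have hG0 : 0 ≤ G := integral_nonneg fun x => by positivity
  have eA : ∫⁻ x in Ω, ‖u x‖ₑ ^ t = ENNReal.ofReal A := by
    rw [hA, ofReal_integral_eq_lintegral_ofReal iA (Filter.Eventually.of_forall fun x => by positivity)]
    refine lintegral_congr fun x => ?_
    rw [← ofReal_norm, ENNReal.ofReal_rpow_of_nonneg (norm_nonneg _) ht0.le, Real.norm_eq_abs]
  have eG : ∫⁻ x in Ω, ‖gradient u x‖ₑ ^ (2:ℝ) = ENNReal.ofReal G := by
    rw [hG, ofReal_integral_eq_lintegral_ofReal iG (Filter.Eventually.of_forall fun x => by positivity)]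
    refine lintegral_congr fun x => ?_
    rw [← ofReal_norm, ENNReal.ofReal_rpow_of_nonneg (norm_nonneg _) (by norm_num), Real.rpow_two]
  have H := duality (volume.restrict Ω) (fun x y => (‖x - y‖ₑ)⁻¹)
    (by change Measurable fun p : EuclideanSpace ℝ (Fin 2) × EuclideanSpace ℝ (Fin 2) => (‖p.1 - p.2‖ₑ)⁻¹
        fun_prop)
    (fun x => ‖u x‖ₑ) (fun x => ‖gradient u x‖ₑ) (by fun_prop) (by fun_prop) t ht
    (ENNReal.ofReal κ) (ENNReal.ofReal (2 * π))
    (by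
      filter_upwards [ae_restrict_mem hΩ.measurableSet] with x hx
      rw [hκ]
      exact kernel_pow Ω hΩ.measurableSet R hR0 hR (t / 2) (2 - 1 / t) (by positivity) (by linarith)
        (by linarith) x hx)
    (by
      intro x
      refine (grad_bound u hu hc x).trans (le_of_eq ?_)
      rw [← lintegral_indicator hΩ.measurableSet]
      refine lintegral_congr fun y => ?_
      by_cases hy : y ∈ Ω
      · rw [Set.indicator_of_mem hy]
      · rw [Set.indicator_of_notMem hy]
        have : gradient u y = 0 := by
          by_contra h
          exact hy (hs (hgs h))
        simp [this])
  rw [eA, eG] at H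
  have hx : 0 ≤ 2 - 2 / t := by
    have : 2 / t = 2 * (1 / t) := by ring
    linarith
  have h2t0 : 0 ≤ 2 / t := by positivity
  rw [ENNReal.ofReal_rpow_of_nonneg hG0 (by norm_num), ENNReal.ofReal_rpow_of_nonneg hA0 hx,
    ENNReal.ofReal_rpow_of_nonneg hκ0 h2t0, ← ENNReal.ofReal_mul (by positivity),
    ← ENNReal.ofReal_mul (by positivity), ENNReal.ofReal_rpow_of_nonneg (by positivity) (by norm_num),
    ← ENNReal.ofReal_mul (by positivity), ENNReal.ofReal_le_ofReal_iff (by positivity),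
    Real.mul_rpow (by positivity) (by positivity), ← Real.rpow_mul hA0, ← Real.rpow_mul hκ0] at H
  rcases hA0.eq_or_lt with h0 | hpos
  · rw [← h0, Real.zero_rpow h1t0.ne']
    positivity
  have e1 : (2 - 2 / t) * (1 / 2) = 1 - 1 / t := by ring
  have e2 : 2 / t * (1 / 2) = 1 / t := by ring
  rw [e1, e2, Real.rpow_sub hpos, Real.rpow_one] at H
  have hAt : 0 < A ^ (1 / t) := by positivity
  have hpi : 0 < 2 * π := by positivity
  have H2 : 2 * π * A * A ^ (1 / t) ≤ (G ^ ((1:ℝ) / 2) * κ ^ (1 / t)) * A := by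
    calc _ ≤ (G ^ ((1:ℝ) / 2) * (A / A ^ (1 / t) * κ ^ (1 / t))) * A ^ (1 / t) := by gcongr
      _ = _ := by field_simp
  have H3 : 2 * π * A ^ (1 / t) ≤ G ^ ((1:ℝ) / 2) * κ ^ (1 / t) := by
    refine le_of_mul_le_mul_right ?_ hpos
    linarith
  rw [mul_assoc, ← div_eq_inv_mul, le_div_iff₀ hpi]
  linarith

/-- Ren–Wei: for every `t ≥ 2` there is `D_t` with
`‖u‖_{L^t(Ω)} ≤ D_t t^{1/2} ‖∇u‖_{L²(Ω)}` for all `u ∈ H¹₀(Ω)` (encoded on the dense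
class of smooth compactly supported functions in `Ω`), and `D_t → (8πe)^{-1/2}`. -/
theorem stmt16 (Ω : Set (EuclideanSpace ℝ (Fin 2))) (hΩ : IsOpen Ω)
    (hbd : Bornology.IsBounded Ω) :
    ∃ D : ℝ → ℝ,
      (∀ t : ℝ, 2 ≤ t → ∀ u : EuclideanSpace ℝ (Fin 2) → ℝ,
        ContDiff ℝ (⊤ : ℕ∞) u → HasCompactSupport u → tsupport u ⊆ Ω →
        (∫ x in Ω, |u x| ^ t) ^ (1 / t) ≤
          D t * t ^ ((1 : ℝ) / 2) * (∫ x in Ω, ‖gradient u x‖ ^ 2) ^ ((1 : ℝ) / 2)) ∧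
      Filter.Tendsto D Filter.atTop (nhds ((8 * π * Real.exp 1) ^ (-(1 : ℝ) / 2))) := by
  obtain ⟨R, hR0, hR⟩ : ∃ R : ℝ, 0 < R ∧ ∀ x ∈ Ω, ∀ y ∈ Ω, ‖x - y‖ < R := by
    obtain ⟨C, hC⟩ := Metric.isBounded_iff.1 hbd
    refine ⟨|C| + 1, by positivity, fun x hx y hy => ?_⟩
    have := hC hx hy
    rw [dist_eq_norm] at this
    linarith [le_abs_self C]
  set M := 2 * π * (3 * R * Real.exp 10) ^ 2 with hM
  have hM0 : 0 < M := by positivity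
  refine ⟨fun t => (4 * π * Real.exp 1 * (2 - 1 / t)) ^ (-(1:ℝ) / 2) * (M ^ (1 / t) * t ^ (1 / t)), ?_, ?_⟩
  · intro t ht u hu hc hs
    have ht0 : 0 < t := by linarith
    have h1t : 1 / t ≤ 1 / 2 := by gcongr
    have hb : 0 < 2 - 1 / t := by linarith
    refine (main_ineq Ω hΩ R hR0 hR t ht u hu hc hs _ ?_ rfl).trans (le_of_eq ?_)
    · rw [sub_sub_cancel]; positivity
    congr 1
    rw [sub_sub_cancel, ← hM, Real.mul_rpow (by positivity) (by positivity), ← Real.rpow_mul (by positivity),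
      show t / 2 * (1 / t) = 1 / 2 by field_simp, show M / (1 / t) = M * t by field_simp,
      Real.mul_rpow (x := M) hM0.le ht0.le]
    have : (2 * π)⁻¹ * (2 * π * (t / 2 / (rexp 1 * (2 - 1 / t)))) ^ (1 / 2 : ℝ) =
       (4 * π * Real.exp 1 * (2 - 1 / t)) ^ (-(1:ℝ) / 2) * t ^ (1 / 2 : ℝ) := by
      rw [show -(1:ℝ) / 2 = -(1 / 2) by ring, Real.rpow_neg (by positivity)]
      rw [← Real.sqrt_eq_rpow, ← Real.sqrt_eq_rpow, ← Real.sqrt_eq_rpow, ← Real.sqrt_inv,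
        ← Real.sqrt_mul (by positivity)]
      rw [← Real.sqrt_sq (show 0 ≤ (2 * π)⁻¹ by positivity), ← Real.sqrt_mul (by positivity)]
      congr 1
      generalize 2 - 1 / t = b at *
      field_simp
      ring
    rw [← mul_assoc, this]
    ring
  · have l1 : Filter.Tendsto (fun t : ℝ => 1 / t) Filter.atTop (nhds 0) := by
      simpa using tendsto_inv_atTop_zero
    have l2 : Filter.Tendsto (fun t : ℝ => M ^ (1 / t)) Filter.atTop (nhds 1) := by
      have := (Real.continuous_const_rpow hM0.ne').tendsto 0 |>.comp l1
      simpa [Function.comp_def] using this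
    have l3 : Filter.Tendsto (fun t : ℝ => t ^ (1 / t)) Filter.atTop (nhds 1) := tendsto_rpow_div
    have l4 : Filter.Tendsto (fun t : ℝ => (4 * π * Real.exp 1 * (2 - 1 / t)) ^ (-(1:ℝ) / 2)) Filter.atTop
        (nhds ((8 * π * Real.exp 1) ^ (-(1 : ℝ) / 2))) := by
      apply Filter.Tendsto.rpow_const
      · have := (l1.const_sub 2).const_mul (4 * π * Real.exp 1)
        convert this using 2
        ring
      · left; positivity
    have := l4.mul (l2.mul l3)
    simpa using this
end
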